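/- arXiv:2009.04558 — 7 statements merged into one kernel-verified Lean document; each statement's English description precedes it below -/
import Mathlib

section
/- Let X be a compact metric space, d ≥ 0 an integer, and S ⊆ X a closed subset. Suppose {C_1, …, C_N} is a finite cover of S by closed subsets of X such that every point lies in at most d+1 of the sets C_i. Then for every ε > 0 there exists a cover {U_1, …, U_N} of S by open subsets of X with C_i ⊆ U_i for each i, such that every point lies in at most d+1 of the sets U_i, and diam(U_i) ≤ diam(C_i) + ε for each i. In particular, the infimum over open covers of S of multiplicity at most d+1 of the supremum of diameters is at most the corresponding infimum over finite closed covers of multiplicity at most d+1. -/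
/-- The Urysohn `d`-width of a subset `S` of a metric space `X`, defined as the
infimum, over all covers of `S` by open subsets of `X` of multiplicity at most
`d+1`, of the supremum of the diameters of the covering sets. -/
noncomputable def openWidth {X : Type*} [MetricSpace X] (d : ℕ) (S : Set X) : ℝ :=
  sInf {w : ℝ | ∃ 𝒰 : Set (Set X),
    (∀ U ∈ 𝒰, IsOpen U) ∧ S ⊆ ⋃₀ 𝒰 ∧
    (∀ x : X, {U ∈ 𝒰 | x ∈ U}.Finite ∧ {U ∈ 𝒰 | x ∈ U}.ncard ≤ d + 1) ∧
    ∀ U ∈ 𝒰, Metric.diam U ≤ w}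

/-- The Urysohn `d`-width of a subset `S` of a metric space `X`, defined as the
infimum, over all finite covers of `S` by closed subsets of `X` of multiplicity
at most `d+1`, of the supremum of the diameters of the covering sets. -/
noncomputable def closedWidth {X : Type*} [MetricSpace X] (d : ℕ) (S : Set X) : ℝ :=
  sInf {w : ℝ | ∃ 𝒞 : Set (Set X), 𝒞.Finite ∧
    (∀ C ∈ 𝒞, IsClosed C) ∧ S ⊆ ⋃₀ 𝒞 ∧
    (∀ x : X, {C ∈ 𝒞 | x ∈ C}.ncard ≤ d + 1) ∧
    ∀ C ∈ 𝒞, Metric.diam C ≤ w}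

/-- A finite family of closed sets in a compact metric space has arbitrarily small thickenings
that create no new intersection pattern: the sets whose thickenings contain a point `x` are
among the sets of the family containing some point `y`. -/
theorem exists_thickening_incidence_subset {X ι : Type*} [PseudoMetricSpace X] [CompactSpace X]
    [Finite ι] (C : ι → Set X) (hC : ∀ i, IsClosed (C i)) :
    ∃ δ > 0, ∀ x : X, ∃ y : X, {i | x ∈ Metric.thickening δ (C i)} ⊆ {i | y ∈ C i} := by
  obtain ⟨δ, hδ, h⟩ := lebesgue_number_lemma_of_metric (s := (Set.univ : Set X))
    (c := fun y : X => ⋂ i : {i // y ∉ C i}, (C i)ᶜ) isCompact_univ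
    (fun y => isOpen_iInter_of_finite fun i => (hC i).isOpen_compl)
    (fun y _ => Set.mem_iUnion.2 ⟨y, Set.mem_iInter.2 fun i => i.2⟩)
  refine ⟨δ, hδ, fun x => ?_⟩
  obtain ⟨y, hy⟩ := h x (Set.mem_univ x)
  refine ⟨y, fun i hi => ?_⟩
  obtain ⟨z, hz, hxz⟩ := Metric.mem_thickening_iff.1 hi
  by_contra hyi
  exact Set.mem_iInter.1 (hy (Metric.mem_ball'.2 hxz)) ⟨i, hyi⟩ hz

/-- A finite family of closed sets in a compact metric space can be enlarged to open sets without
raising the multiplicity and with an arbitrarily small increase of the diameters. -/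
theorem exists_isOpen_superset_ncard_le_diam_le {X ι : Type*} [PseudoMetricSpace X]
    [CompactSpace X] [Finite ι] {m : ℕ} (C : ι → Set X) (hC : ∀ i, IsClosed (C i))
    (hm : ∀ x : X, {i | x ∈ C i}.ncard ≤ m) {ε : ℝ} (hε : 0 < ε) :
    ∃ U : ι → Set X, (∀ i, IsOpen (U i)) ∧ (∀ i, C i ⊆ U i) ∧
      (∀ x : X, {i | x ∈ U i}.ncard ≤ m) ∧
      ∀ i, Metric.diam (U i) ≤ Metric.diam (C i) + ε := by
  obtain ⟨δ, hδ, h⟩ := exists_thickening_incidence_subset C hC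
  have hη : 0 < min δ (ε / 2) := lt_min hδ (half_pos hε)
  refine ⟨fun i => Metric.thickening (min δ (ε / 2)) (C i),
    fun i => Metric.isOpen_thickening, fun i => Metric.self_subset_thickening hη _,
    fun x => ?_, fun i => ?_⟩
  · obtain ⟨y, hy⟩ := h x
    refine (Set.ncard_le_ncard (fun i hi => hy ?_) (Set.toFinite _)).trans (hm y)
    exact Metric.thickening_mono (min_le_left _ _) _ hi
  · have := Metric.diam_thickening_le (C i) hη.le
    linarith [min_le_right δ (ε / 2)]

/-- In a compact metric space the open-cover Urysohn width is at most the closed-cover one. -/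
theorem openWidth_le_closedWidth {X : Type*} [MetricSpace X] [CompactSpace X]
    (d : ℕ) (S : Set X) : openWidth d S ≤ closedWidth d S := by
  rcases S.eq_empty_or_nonempty with rfl | ⟨p, hp⟩
  · have h_open : openWidth d (∅ : Set X) = 0 := by
      refine (congrArg sInf (Set.eq_univ_of_forall ?_)).trans Real.sInf_univ
      exact fun w => ⟨∅, by simp⟩
    have h_closed : closedWidth d (∅ : Set X) = 0 := by
      refine (congrArg sInf (Set.eq_univ_of_forall ?_)).trans Real.sInf_univ
      exact fun w => ⟨∅, by simp⟩
    rw [h_open, h_closed]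
  · refine le_csInf ⟨Metric.diam (Set.univ : Set X), {Set.univ}, Set.finite_singleton _, by simp,
      by simp, fun x => ?_, by simp⟩ ?_
    · exact (Set.ncard_le_ncard (Set.sep_subset _ _) (Set.finite_singleton _)).trans (by simp)
    rintro w ⟨𝒞, h_fin, h_closed, h_cover, h_mult, h_diam⟩
    refine le_of_forall_pos_le_add fun ε hε => ?_
    have := h_fin.to_subtype
    obtain ⟨U, hU_open, hCU, hU_mult, hU_diam⟩ :=
      exists_isOpen_superset_ncard_le_diam_le (m := d + 1) (fun C : 𝒞 => (C : Set X))
        (fun C => h_closed C C.2) (fun x => by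
          refine le_trans (le_of_eq ?_) (h_mult x)
          rw [← Set.ncard_image_of_injective _ Subtype.val_injective]
          congr 1
          ext C
          simp [and_comm]) hε
    refine csInf_le ⟨0, ?_⟩ ⟨Set.range U, ?_, ?_, fun x => ?_, ?_⟩
    · rintro v ⟨𝒰, -, h_cov, -, hv⟩
      obtain ⟨V, hV, -⟩ := h_cov hp
      exact Metric.diam_nonneg.trans (hv V hV)
    · rintro _ ⟨C, rfl⟩
      exact hU_open C
    · intro x hx
      obtain ⟨C, hC, hxC⟩ := h_cover hx
      exact ⟨_, ⟨⟨C, hC⟩, rfl⟩, hCU ⟨C, hC⟩ hxC⟩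
    · have h_image : {V ∈ Set.range U | x ∈ V} = U '' {C | x ∈ U C} := by
        ext V
        constructor
        · rintro ⟨⟨C, rfl⟩, hx⟩
          exact ⟨C, hx, rfl⟩
        · rintro ⟨C, hx, rfl⟩
          exact ⟨⟨C, rfl⟩, hx⟩
      rw [h_image]
      exact ⟨Set.toFinite _, (Set.ncard_image_le (Set.toFinite _)).trans (hU_mult x)⟩
    · rintro _ ⟨C, rfl⟩
      exact (hU_diam C).trans (by linarith [h_diam C C.2])

/-- Given a finite closed cover `C₁, …, C_N` of a closed subset `S` of a compact
metric space `X` of multiplicity at most `d+1`, for every `ε > 0` there is an open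
cover `U₁, …, U_N` of `S` with `Cᵢ ⊆ Uᵢ`, of multiplicity at most `d+1`, and with
`diam Uᵢ ≤ diam Cᵢ + ε`.  In particular, the open-cover Urysohn `d`-width of `S`
is at most its closed-cover Urysohn `d`-width. -/
theorem closed_cover_to_open_cover {X : Type*} [MetricSpace X] [CompactSpace X]
    (d : ℕ) (S : Set X) (hS : IsClosed S) :
    (∀ (N : ℕ) (C : Fin N → Set X),
      (∀ i, IsClosed (C i)) →
      S ⊆ ⋃ i, C i →
      (∀ x : X, {i | x ∈ C i}.ncard ≤ d + 1) →
      ∀ ε > 0, ∃ U : Fin N → Set X,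
        (∀ i, IsOpen (U i)) ∧
        S ⊆ ⋃ i, U i ∧
        (∀ i, C i ⊆ U i) ∧
        (∀ x : X, {i | x ∈ U i}.ncard ≤ d + 1) ∧
        ∀ i, Metric.diam (U i) ≤ Metric.diam (C i) + ε) ∧
    openWidth d S ≤ closedWidth d S := by
  refine ⟨fun N C hC hSC hm ε hε => ?_, openWidth_le_closedWidth d S⟩
  obtain ⟨U, hU_open, hCU, hU_mult, hU_diam⟩ := exists_isOpen_superset_ncard_le_diam_le C hC hm hε
  exact ⟨U, hU_open, hSC.trans (Set.iUnion_mono hCU), hCU, hU_mult, hU_diam⟩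
end

section
/- Let S be a nonempty compact metric space, d ≥ 0 an integer, and Z a metric space with the property that every open cover of Z admits an open refinement in which every point lies in at most d+1 sets (this expresses that Z has covering dimension at most d). Let p : S → Z be a continuous map, and let W(p) = sup_{z ∈ Z} diam(p⁻¹(z)) be the width of p. Then for every ε > 0 there exists a finite cover of S by closed sets, each of diameter less than W(p) + ε, such that every point of S lies in at most d+1 of the sets. Consequently, the infimum over finite closed covers of S of multiplicity at most d+1 of the supremum of diameters is at most W(p). -/
/-- For a continuous map out of a compact metric space, each point of the target has an open
neighborhood whose preimage has diameter only slightly larger than that of its fiber. -/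
theorem exists_isOpen_diam_preimage_le {S Z : Type*} [MetricSpace S] [CompactSpace S]
    [MetricSpace Z] {p : S → Z} (hp : Continuous p) (z : Z) {δ : ℝ} (hδ : 0 < δ) :
    ∃ U : Set Z, IsOpen U ∧ z ∈ U ∧
      Metric.diam (p ⁻¹' U) ≤ Metric.diam (p ⁻¹' {z}) + 2 * δ := by
  have hb (A : Set S) : Bornology.IsBounded A := isCompact_univ.isBounded.subset A.subset_univ
  refine ⟨(p '' (Metric.thickening δ (p ⁻¹' {z}))ᶜ)ᶜ, ?_, ?_, ?_⟩
  · exact (hp.isClosedMap _ Metric.isOpen_thickening.isClosed_compl).isOpen_compl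
  · rintro ⟨x, hx, hxz⟩
    exact hx (Metric.self_subset_thickening hδ _ hxz)
  · refine (Metric.diam_mono (fun x hx => ?_) (hb _)).trans (Metric.diam_thickening_le _ hδ.le)
    by_contra hn
    exact hx ⟨x, hn, rfl⟩

/-- A finite closed cover of multiplicity at most `d + 1` by sets of diameter at most `w`
bounds the closed-cover width by `w`. -/
theorem closedWidth_univ_le_of_cover {S : Type*} [MetricSpace S] [Nonempty S] {d N : ℕ}
    {C : Fin N → Set S} {w : ℝ} (hC : ∀ i, IsClosed (C i)) (hU : (⋃ i, C i) = Set.univ)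
    (hm : ∀ x, {i | x ∈ C i}.ncard ≤ d + 1) (hw : ∀ i, Metric.diam (C i) ≤ w) :
    closedWidth d (Set.univ : Set S) ≤ w := by
  refine csInf_le ⟨0, ?_⟩ ⟨Set.range C, Set.finite_range C, ?_, ?_, fun x => ?_, ?_⟩
  · rintro v ⟨𝒞, -, -, hcov, -, hv⟩
    obtain ⟨x⟩ := ‹Nonempty S›
    obtain ⟨A, hA, -⟩ := hcov (Set.mem_univ x)
    exact Metric.diam_nonneg.trans (hv A hA)
  · rintro _ ⟨i, rfl⟩
    exact hC i
  · rw [Set.sUnion_range, hU]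
  · have h : {A ∈ Set.range C | x ∈ A} = C '' {i | x ∈ C i} := by
      ext A
      constructor
      · rintro ⟨⟨i, rfl⟩, hx⟩
        exact ⟨i, hx, rfl⟩
      · rintro ⟨i, hx, rfl⟩
        exact ⟨⟨i, rfl⟩, hx⟩
    rw [h]
    exact (Set.ncard_image_le (Set.toFinite _)).trans (hm x)
  · rintro _ ⟨i, rfl⟩
    exact hw i

/-- Let `S` be a nonempty compact metric space and `Z` a metric space of covering
dimension at most `d` (every open cover of `Z` admits an open refinement of
multiplicity at most `d+1`).  Let `p : S → Z` be continuous, with width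
`W(p) = ⨆ z, diam (p⁻¹ z)`.  Then for every `ε > 0` there is a finite closed
cover of `S` of multiplicity at most `d+1` with all sets of diameter
`< W(p) + ε`; consequently the closed-cover Urysohn `d`-width of `S` is at most
`W(p)`. -/
theorem closedWidth_le_width_of_map {S : Type*} [MetricSpace S] [CompactSpace S]
    [Nonempty S] {Z : Type*} [MetricSpace Z] (d : ℕ)
    (hZ : ∀ 𝒰 : Set (Set Z), (∀ U ∈ 𝒰, IsOpen U) → ⋃₀ 𝒰 = Set.univ →
      ∃ 𝒱 : Set (Set Z), (∀ V ∈ 𝒱, IsOpen V) ∧ ⋃₀ 𝒱 = Set.univ ∧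
        (∀ V ∈ 𝒱, ∃ U ∈ 𝒰, V ⊆ U) ∧
        ∀ z : Z, {V ∈ 𝒱 | z ∈ V}.Finite ∧ {V ∈ 𝒱 | z ∈ V}.ncard ≤ d + 1)
    (p : S → Z) (hp : Continuous p) :
    (∀ ε > 0, ∃ (N : ℕ) (C : Fin N → Set S),
      (∀ i, IsClosed (C i)) ∧
      (⋃ i, C i) = Set.univ ∧
      (∀ i, Metric.diam (C i) < (⨆ z : Z, Metric.diam (p ⁻¹' {z})) + ε) ∧
      ∀ x : S, {i | x ∈ C i}.ncard ≤ d + 1) ∧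
    closedWidth d (Set.univ : Set S) ≤ ⨆ z : Z, Metric.diam (p ⁻¹' {z}) := by
  have cover : ∀ ε > 0, ∃ (N : ℕ) (C : Fin N → Set S),
      (∀ i, IsClosed (C i)) ∧
      (⋃ i, C i) = Set.univ ∧
      (∀ i, Metric.diam (C i) < (⨆ z : Z, Metric.diam (p ⁻¹' {z})) + ε) ∧
      ∀ x : S, {i | x ∈ C i}.ncard ≤ d + 1 := by
    intro ε hε
    have hb (A : Set S) : Bornology.IsBounded A :=
      isCompact_univ.isBounded.subset A.subset_univ
    have hbdd : BddAbove (Set.range fun z : Z => Metric.diam (p ⁻¹' {z})) := by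
      refine ⟨Metric.diam (Set.univ : Set S), ?_⟩
      rintro _ ⟨z, rfl⟩
      exact Metric.diam_mono (Set.subset_univ _) (hb _)
    obtain ⟨𝒱, hVo, hVc, hVr, hVm⟩ := hZ
      {U | IsOpen U ∧ Metric.diam (p ⁻¹' U) < (⨆ z : Z, Metric.diam (p ⁻¹' {z})) + ε}
      (fun U hU => hU.1) (Set.eq_univ_of_forall fun z => by
        obtain ⟨U, hUo, hzU, hU⟩ :=
          exists_isOpen_diam_preimage_le hp z (δ := ε / 4) (by positivity)
        exact ⟨U, ⟨hUo, by linarith [le_ciSup hbdd z]⟩, hzU⟩)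
    obtain ⟨t, ht⟩ := isCompact_univ.elim_finite_subcover (fun V : 𝒱 => p ⁻¹' (V : Set Z))
      (fun V => (hVo V V.2).preimage hp) (fun x _ => by
        obtain ⟨V, hV, hx⟩ := Set.eq_univ_iff_forall.1 hVc (p x)
        exact Set.mem_iUnion.2 ⟨⟨V, hV⟩, hx⟩)
    let V (i : Fin t.card) : Set Z := (t.equivFin.symm i : 𝒱)
    have hV𝒱 (i) : V i ∈ 𝒱 := (t.equivFin.symm i : 𝒱).2
    have hVinj : Function.Injective V := Subtype.val_injective.comp
      (Subtype.val_injective.comp t.equivFin.symm.injective)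
    obtain ⟨C, hCu, hCc, hCV⟩ := exists_iUnion_eq_closed_subset (u := fun i => p ⁻¹' V i)
      (fun i => (hVo _ (hV𝒱 i)).preimage hp) (fun x => Set.toFinite _)
      (Set.eq_univ_of_forall fun x => by
        obtain ⟨A, hA, hx⟩ := Set.mem_iUnion₂.1 (ht (Set.mem_univ x))
        refine Set.mem_iUnion.2 ⟨t.equivFin ⟨A, hA⟩, ?_⟩
        simpa [V] using hx)
    refine ⟨t.card, C, hCc, hCu, fun i => ?_, fun x => ?_⟩
    · obtain ⟨U, hU, hVU⟩ := hVr _ (hV𝒱 i)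
      exact (Metric.diam_mono ((hCV i).trans (Set.preimage_mono hVU)) (hb _)).trans_lt hU.2
    · exact (Set.ncard_le_ncard_of_injOn (t := {A ∈ 𝒱 | p x ∈ A}) V
        (fun i hi => ⟨hV𝒱 i, hCV i hi⟩) hVinj.injOn (hVm (p x)).1).trans (hVm (p x)).2
  refine ⟨cover, le_of_forall_pos_le_add fun ε hε => ?_⟩
  obtain ⟨N, C, hC, hU, hw, hm⟩ := cover ε hε
  exact closedWidth_univ_le_of_cover hC hU hm fun i => (hw i).le
end

section
/- Let X be a compact metric space, d ≥ 0 an integer, and S ⊆ X a closed subset. Then the two definitions of the Urysohn d-width of S coincide: the infimum, over all covers of S by open subsets of X with multiplicity at most d+1, of the supremum of the diameters of the covering sets, equals the infimum, over all finite covers of S by closed subsets of X with multiplicity at most d+1, of the supremum of the diameters of the covering sets. -/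
open Set Metric

/-- Thickening finitely many closed subsets of a compact space by a small amount does not
increase their multiplicity. -/
theorem exists_thickening_mem_imp_mem {X : Type*} [MetricSpace X] [CompactSpace X]
    {𝒞 : Set (Set X)} (hfin : 𝒞.Finite) (hcl : ∀ C ∈ 𝒞, IsClosed C) :
    ∃ δ > 0, ∀ y : X, ∃ x : X, ∀ C ∈ 𝒞, y ∈ thickening δ C → x ∈ C := by
  obtain ⟨δ, hδ, h⟩ := lebesgue_number_lemma_of_metric (s := (univ : Set X)) (ι := X)
    (c := fun x => (⋃₀ {C ∈ 𝒞 | x ∉ C})ᶜ) isCompact_univ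
    (fun x => by
      rw [sUnion_eq_biUnion]
      refine (Set.Finite.isClosed_biUnion (hfin.subset (sep_subset _ _)) ?_).isOpen_compl
      exact fun C hC => hcl C hC.1)
    (fun x _ => mem_iUnion.2 ⟨x, fun ⟨C, hC, hxC⟩ => hC.2 hxC⟩)
  refine ⟨δ, hδ, fun y => ?_⟩
  obtain ⟨x, hx⟩ := h y (mem_univ y)
  refine ⟨x, fun C hC hy => ?_⟩
  by_contra hxC
  obtain ⟨z, hz, hyz⟩ := mem_thickening_iff.1 hy
  exact hx (mem_ball'.2 hyz) ⟨C, ⟨hC, hxC⟩, hz⟩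

/-- The images of a family of sets under a map that sends members through `y` to members
through `x` have multiplicity at `y` at most that of the family at `x`. -/
theorem ncard_sep_image_le {X : Type*} {𝒜 : Set (Set X)} (f : Set X → Set X) {x y : X}
    (hfin : {A ∈ 𝒜 | x ∈ A}.Finite) (h : ∀ A ∈ 𝒜, y ∈ f A → x ∈ A) :
    {B ∈ f '' 𝒜 | y ∈ B}.ncard ≤ {A ∈ 𝒜 | x ∈ A}.ncard := by
  have hsub : {B ∈ f '' 𝒜 | y ∈ B} ⊆ f '' {A ∈ 𝒜 | x ∈ A} := by
    rintro _ ⟨⟨A, hA, rfl⟩, hy⟩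
    exact ⟨A, ⟨hA, h A hA hy⟩, rfl⟩
  exact (ncard_le_ncard hsub (hfin.image f)).trans (ncard_image_le hfin)

/-- A finite closed cover of a subset of a compact metric space can be enlarged to a finite open
cover without increasing its multiplicity, increasing the diameters arbitrarily little. -/
theorem exists_open_cover_of_closed_cover {X : Type*} [MetricSpace X] [CompactSpace X] {d : ℕ}
    {S : Set X} {𝒞 : Set (Set X)} (hfin : 𝒞.Finite) (hcl : ∀ C ∈ 𝒞, IsClosed C)
    (hcov : S ⊆ ⋃₀ 𝒞) (hmul : ∀ x : X, {C ∈ 𝒞 | x ∈ C}.ncard ≤ d + 1) {w ε : ℝ}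
    (hw : ∀ C ∈ 𝒞, diam C ≤ w) (hε : 0 < ε) :
    ∃ 𝒰 : Set (Set X), (∀ U ∈ 𝒰, IsOpen U) ∧ S ⊆ ⋃₀ 𝒰 ∧
      (∀ x : X, {U ∈ 𝒰 | x ∈ U}.Finite ∧ {U ∈ 𝒰 | x ∈ U}.ncard ≤ d + 1) ∧
      ∀ U ∈ 𝒰, diam U ≤ w + ε := by
  obtain ⟨δ, hδ, h⟩ := exists_thickening_mem_imp_mem hfin hcl
  set r := min δ (ε / 2)
  have hr : 0 < r := lt_min hδ (half_pos hε)
  refine ⟨thickening r '' 𝒞, ?_, ?_, fun y => ⟨(hfin.image _).subset (sep_subset _ _), ?_⟩, ?_⟩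
  · rintro _ ⟨C, -, rfl⟩
    exact isOpen_thickening
  · intro x hx
    obtain ⟨C, hC, hxC⟩ := hcov hx
    exact ⟨_, ⟨C, hC, rfl⟩, self_subset_thickening hr C hxC⟩
  · obtain ⟨x, hx⟩ := h y
    refine (ncard_sep_image_le _ (hfin.subset (sep_subset _ _)) fun C hC hy => ?_).trans (hmul x)
    exact hx C hC (thickening_mono (min_le_left _ _) C hy)
  · rintro _ ⟨C, hC, rfl⟩
    have h₁ := diam_thickening_le C hr.le
    have h₂ := hw C hC
    have h₃ : r ≤ ε / 2 := min_le_right _ _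
    linarith

/-- An open cover of a closed subset of a compact metric space can be shrunk to a finite closed
cover without increasing its multiplicity or the diameters. -/
theorem exists_closed_cover_of_open_cover {X : Type*} [MetricSpace X] [CompactSpace X] {d : ℕ}
    {S : Set X} (hS : IsClosed S) {𝒰 : Set (Set X)} (hop : ∀ U ∈ 𝒰, IsOpen U)
    (hcov : S ⊆ ⋃₀ 𝒰)
    (hmul : ∀ x : X, {U ∈ 𝒰 | x ∈ U}.Finite ∧ {U ∈ 𝒰 | x ∈ U}.ncard ≤ d + 1) {w : ℝ}
    (hw : ∀ U ∈ 𝒰, diam U ≤ w) :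
    ∃ 𝒞 : Set (Set X), 𝒞.Finite ∧ (∀ C ∈ 𝒞, IsClosed C) ∧ S ⊆ ⋃₀ 𝒞 ∧
      (∀ x : X, {C ∈ 𝒞 | x ∈ C}.ncard ≤ d + 1) ∧ ∀ C ∈ 𝒞, diam C ≤ w := by
  obtain ⟨𝒱, hsub, hfin, hcov'⟩ :=
    hS.isCompact.elim_finite_subcover_image hop (c := id) (sUnion_eq_biUnion ▸ hcov)
  replace hcov' : S ⊆ ⋃₀ 𝒱 := sUnion_eq_biUnion ▸ hcov'
  obtain ⟨δ, hδ, h⟩ := lebesgue_number_lemma_of_metric_sUnion hS.isCompact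
    (fun V hV => hop V (hsub hV)) hcov'
  have hshrink (V : Set X) : (thickening δ Vᶜ)ᶜ ⊆ V :=
    compl_subset_comm.1 (self_subset_thickening hδ Vᶜ)
  refine ⟨(fun V => (thickening δ Vᶜ)ᶜ) '' 𝒱, hfin.image _, ?_, ?_, fun x => ?_, ?_⟩
  · rintro _ ⟨V, -, rfl⟩
    exact isOpen_thickening.isClosed_compl
  · intro x hx
    obtain ⟨V, hV, hxV⟩ := h x hx
    refine ⟨_, ⟨V, hV, rfl⟩, fun hx' => ?_⟩
    obtain ⟨z, hz, hxz⟩ := mem_thickening_iff.1 hx'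
    exact hz (hxV (mem_ball'.2 hxz))
  · refine (ncard_sep_image_le _ (hfin.subset (sep_subset _ _))
      fun V _ hx => hshrink V hx).trans (le_trans (ncard_le_ncard ?_ (hmul x).1) (hmul x).2)
    exact fun V hV => ⟨hsub hV.1, hV.2⟩
  · rintro _ ⟨V, hV, rfl⟩
    exact (diam_mono (hshrink V) (isBounded_of_compactSpace)).trans (hw V (hsub hV))

/-- An upper bound for the diameters of the members of a cover of a nonempty set is
nonnegative. -/
theorem nonneg_of_cover_diam_le {X : Type*} [MetricSpace X] {S : Set X} (hS : S.Nonempty)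
    {𝒜 : Set (Set X)} (hcov : S ⊆ ⋃₀ 𝒜) {w : ℝ} (hw : ∀ A ∈ 𝒜, diam A ≤ w) : 0 ≤ w := by
  obtain ⟨x, hx⟩ := hS
  obtain ⟨A, hA, -⟩ := hcov hx
  exact diam_nonneg.trans (hw A hA)

/-- For a closed subset `S` of a compact metric space `X`, the open-cover and the
finite-closed-cover definitions of the Urysohn `d`-width of `S` coincide. -/
theorem openWidth_eq_closedWidth {X : Type*} [MetricSpace X] [CompactSpace X]
    (d : ℕ) (S : Set X) (hS : IsClosed S) :
    openWidth d S = closedWidth d S := by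
  rcases S.eq_empty_or_nonempty with rfl | hne
  · unfold openWidth closedWidth
    congr 1
    ext w
    exact iff_of_true ⟨∅, by simp⟩ ⟨∅, by simp⟩
  · apply le_antisymm
    · refine le_csInf ⟨diam (univ : Set X), {univ}, finite_singleton _, by simp, by simp,
        fun x => ?_, by simp⟩ ?_
      · exact (ncard_le_ncard (sep_subset _ _) (finite_singleton _)).trans (by simp)
      · rintro w ⟨𝒞, hfin, hcl, hcov, hmul, hw⟩
        refine le_of_forall_pos_le_add fun ε hε => csInf_le ⟨0, ?_⟩
          (exists_open_cover_of_closed_cover hfin hcl hcov hmul hw hε)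
        rintro v ⟨𝒰, -, hcov', -, hv⟩
        exact nonneg_of_cover_diam_le hne hcov' hv
    · refine le_csInf ⟨diam (univ : Set X), {univ}, by simp, by simp,
        fun x => ⟨(finite_singleton _).subset (sep_subset _ _), ?_⟩, by simp⟩ ?_
      · exact (ncard_le_ncard (sep_subset _ _) (finite_singleton _)).trans (by simp)
      · rintro w ⟨𝒰, hop, hcov, hmul, hw⟩
        refine csInf_le ⟨0, ?_⟩ (exists_closed_cover_of_open_cover hS hop hcov hmul hw)
        rintro v ⟨𝒞, -, -, hcov', -, hv⟩
        exact nonneg_of_cover_diam_le hne hcov' hv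
end

section
/- Let f : X → Y be a continuous map from a compact metric space X to a metric space Y, and let d ≥ 0 be an integer. Then the function y ↦ UW_d(f⁻¹(y)) is upper semi-continuous on Y: for every y ∈ Y and every w > UW_d(f⁻¹(y)) there is an open neighborhood V of y such that UW_d(f⁻¹(y')) < w for all y' ∈ V. In particular, UW_d(f⁻¹(y)) ≥ limsup_{y' → y} UW_d(f⁻¹(y')). -/
theorem openWidth_empty {X : Type*} [MetricSpace X] (d : ℕ) :
    openWidth d (∅ : Set X) = 0 := by
  refine Eq.trans (congrArg sInf (Set.eq_univ_of_forall fun r => ?_)) Real.sInf_univ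
  exact ⟨∅, by simp⟩

/-- A nonnegative bound on the diameters of an admissible open cover bounds the width. -/
theorem openWidth_le_of_cover {X : Type*} [MetricSpace X] {d : ℕ} {S : Set X} {r : ℝ}
    (hr : 0 ≤ r) {𝒰 : Set (Set X)} (hopen : ∀ U ∈ 𝒰, IsOpen U) (hcover : S ⊆ ⋃₀ 𝒰)
    (hmult : ∀ x : X, {U ∈ 𝒰 | x ∈ U}.Finite ∧ {U ∈ 𝒰 | x ∈ U}.ncard ≤ d + 1)
    (hdiam : ∀ U ∈ 𝒰, Metric.diam U ≤ r) : openWidth d S ≤ r := by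
  rcases S.eq_empty_or_nonempty with rfl | ⟨x, hx⟩
  · rwa [openWidth_empty]
  · refine csInf_le ⟨0, ?_⟩ ⟨𝒰, hopen, hcover, hmult, hdiam⟩
    rintro s ⟨𝒱, -, hcov, -, hs⟩
    obtain ⟨U, hU, -⟩ := hcov hx
    exact Metric.diam_nonneg.trans (hs U hU)

/-- Any number above the width is beaten by an admissible open cover with a nonnegative
diameter bound. -/
theorem exists_cover_of_openWidth_lt {X : Type*} [MetricSpace X] {d : ℕ} {S : Set X} {w : ℝ}
    (hw : openWidth d S < w) :
    ∃ r, 0 ≤ r ∧ r < w ∧ ∃ 𝒰 : Set (Set X),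
      (∀ U ∈ 𝒰, IsOpen U) ∧ S ⊆ ⋃₀ 𝒰 ∧
      (∀ x : X, {U ∈ 𝒰 | x ∈ U}.Finite ∧ {U ∈ 𝒰 | x ∈ U}.ncard ≤ d + 1) ∧
      ∀ U ∈ 𝒰, Metric.diam U ≤ r := by
  rcases S.eq_empty_or_nonempty with rfl | ⟨x, hx⟩
  · rw [openWidth_empty] at hw
    exact ⟨0, le_rfl, hw, ∅, by simp⟩
  · obtain ⟨r, ⟨𝒰, hopen, hcover, hmult, hdiam⟩, hr⟩ := exists_lt_of_csInf_lt (by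
      refine ⟨Metric.diam (Set.univ : Set X), {Set.univ}, by simp, by simp, fun z => ?_, by simp⟩
      have hsub : {U ∈ ({Set.univ} : Set (Set X)) | z ∈ U} ⊆ {Set.univ} := Set.sep_subset _ _
      refine ⟨(Set.finite_singleton _).subset hsub, ?_⟩
      have hcard := Set.ncard_le_ncard hsub (Set.finite_singleton _)
      rw [Set.ncard_singleton] at hcard
      omega) hw
    obtain ⟨U, hU, -⟩ := hcover hx
    exact ⟨r, Metric.diam_nonneg.trans (hdiam U hU), hr, 𝒰, hopen, hcover, hmult, hdiam⟩

/-- For a continuous map `f : X → Y` from a compact metric space to a metric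
space, the function `y ↦ UW_d (f⁻¹ y)` is upper semi-continuous: for every `y`
and every `w > UW_d (f⁻¹ y)`, there is an open neighborhood `V` of `y` such that
`UW_d (f⁻¹ y') < w` for all `y' ∈ V`. -/
theorem urysohnWidth_fiber_upperSemicontinuous {X Y : Type*} [MetricSpace X]
    [CompactSpace X] [MetricSpace Y] (f : X → Y) (hf : Continuous f) (d : ℕ)
    (y : Y) (w : ℝ) (hw : openWidth d (f ⁻¹' {y}) < w) :
    ∃ V : Set Y, IsOpen V ∧ y ∈ V ∧ ∀ y' ∈ V, openWidth d (f ⁻¹' {y'}) < w := by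
  obtain ⟨r, hr, hrw, 𝒰, hopen, hcover, hmult, hdiam⟩ := exists_cover_of_openWidth_lt hw
  have hclosed : IsClosed (f '' (⋃₀ 𝒰)ᶜ) :=
    hf.isClosedMap _ (isOpen_sUnion hopen).isClosed_compl
  refine ⟨(f '' (⋃₀ 𝒰)ᶜ)ᶜ, hclosed.isOpen_compl, ?_, fun y' hy' => ?_⟩
  · rintro ⟨x, hx, hxy⟩
    exact hx (hcover hxy)
  · refine (openWidth_le_of_cover hr hopen (fun x hx => ?_) hmult hdiam).trans_lt hrw
    by_contra hxU
    exact hy' ⟨x, hxU, hx⟩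
end

section
/- Let m, d ≥ 0 be integers, set n = (m+1)(d+1) − 1, and let ε > 0. Then there exists a continuous map f : B^n → Δ^m from the closed unit euclidean ball B^n ⊂ ℝ^n to the standard m-simplex Δ^m = {t ∈ ℝ^{m+1} : t_i ≥ 0, Σ t_i = 1}, such that every fiber f⁻¹(t), t ∈ Δ^m, has Urysohn d-width UW_d(f⁻¹(t)) < ε (width measured with respect to the euclidean metric on B^n). -/
theorem openWidth_le {X : Type*} [MetricSpace X] {d : ℕ} {S : Set X} {w : ℝ} (hw : 0 ≤ w)
    {𝒰 : Set (Set X)} (hopen : ∀ U ∈ 𝒰, IsOpen U) (hcover : S ⊆ ⋃₀ 𝒰)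
    (hmult : ∀ x : X, {U ∈ 𝒰 | x ∈ U}.Finite ∧ {U ∈ 𝒰 | x ∈ U}.ncard ≤ d + 1)
    (hdiam : ∀ U ∈ 𝒰, Metric.diam U ≤ w) : openWidth d S ≤ w := by
  unfold openWidth
  by_cases hb : BddBelow {w : ℝ | ∃ 𝒰 : Set (Set X),
    (∀ U ∈ 𝒰, IsOpen U) ∧ S ⊆ ⋃₀ 𝒰 ∧
    (∀ x : X, {U ∈ 𝒰 | x ∈ U}.Finite ∧ {U ∈ 𝒰 | x ∈ U}.ncard ≤ d + 1) ∧
    ∀ U ∈ 𝒰, Metric.diam U ≤ w}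
  · exact csInf_le hb ⟨𝒰, hopen, hcover, hmult, hdiam⟩
  · rw [Real.sInf_of_not_bddBelow hb]
    exact hw

/-- The open cube of side `1 / s` with index `z` in the grid of `ℝ^ι` shifted by `r / s`,
intersected with a subset `B`. -/
def gridCell {ι : Type*} [Fintype ι] (B : Set (EuclideanSpace ℝ ι)) (s r : ℝ) (z : ι → ℤ) :
    Set B :=
  {x | ∀ j, (z j : ℝ) < s * x.1 j - r ∧ s * x.1 j - r < z j + 1}

section GridCell

variable {ι : Type*} [Fintype ι] {B : Set (EuclideanSpace ℝ ι)} {s r : ℝ}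

theorem isOpen_gridCell (z : ι → ℤ) : IsOpen (gridCell B s r z) := by
  have hcont (j : ι) : Continuous fun x : B => s * x.1 j - r := by fun_prop
  simp only [gridCell, Set.ofPred_forall]
  exact isOpen_iInter_of_finite fun j =>
    (isOpen_lt continuous_const (hcont j)).inter (isOpen_lt (hcont j) continuous_const)

theorem eq_floor_of_mem_gridCell {z : ι → ℤ} {x : B} (hx : x ∈ gridCell B s r z) :
    z = fun j => ⌊s * x.1 j - r⌋ := by
  funext j
  exact (Int.floor_eq_iff.2 ⟨(hx j).1.le, (hx j).2⟩).symm

theorem mem_gridCell_floor {x : B} (hx : ∀ j, ∀ k : ℤ, (k : ℝ) ≠ s * x.1 j - r) :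
    x ∈ gridCell B s r fun j => ⌊s * x.1 j - r⌋ :=
  fun j => ⟨lt_of_le_of_ne (Int.floor_le _) (hx j _), Int.lt_floor_add_one _⟩

theorem diam_gridCell_le (hs : 0 < s) (z : ι → ℤ) :
    Metric.diam (gridCell B s r z) ≤ (Fintype.card ι + 1) / s := by
  refine Metric.diam_le_of_forall_dist_le (by positivity) fun x hx y hy => ?_
  have hcoord (j : ι) : dist (x.1 j) (y.1 j) ≤ 1 / s := by
    rw [Real.dist_eq, abs_le]
    have h1 := hx j
    have h2 := hy j
    constructor
    · rw [← neg_div, div_le_iff₀ hs]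
      linarith
    · rw [le_div_iff₀ hs]
      linarith
  rw [Subtype.dist_eq, EuclideanSpace.dist_eq]
  refine Real.sqrt_le_iff.2 ⟨by positivity, ?_⟩
  calc ∑ j, dist (x.1 j) (y.1 j) ^ 2 ≤ ∑ _j : ι, (1 / s) ^ 2 :=
        Finset.sum_le_sum fun j _ => pow_le_pow_left₀ dist_nonneg (hcoord j) 2
    _ = Fintype.card ι * (1 / s) ^ 2 := by simp
    _ ≤ (Fintype.card ι + 1) ^ 2 * (1 / s) ^ 2 := by
        gcongr
        nlinarith [(Nat.cast_nonneg (Fintype.card ι) : (0 : ℝ) ≤ _)]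
    _ = ((Fintype.card ι + 1) / s) ^ 2 := by ring

end GridCell

/-- A nonnegative function vanishing exactly on the walls of the grid of side `1 / s`
shifted by `r / s`. -/
noncomputable def gridWeight {ι : Type*} [Fintype ι] (s r : ℝ) (x : EuclideanSpace ℝ ι) : ℝ :=
  ∏ j, |Real.sin ((s * x j - r) * Real.pi)|

section GridWeight

variable {ι : Type*} [Fintype ι] {s : ℝ}

theorem continuous_gridWeight (r : ℝ) : Continuous (gridWeight (ι := ι) s r) := by
  unfold gridWeight
  fun_prop

theorem gridWeight_nonneg (r : ℝ) (x : EuclideanSpace ℝ ι) : 0 ≤ gridWeight s r x :=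
  Finset.prod_nonneg fun _ _ => abs_nonneg _

theorem gridWeight_ne_zero_iff {r : ℝ} {x : EuclideanSpace ℝ ι} :
    gridWeight s r x ≠ 0 ↔ ∀ j, ∀ k : ℤ, (k : ℝ) ≠ s * x j - r := by
  simp [gridWeight, Finset.prod_ne_zero_iff, Real.sin_eq_zero_iff, Real.pi_ne_zero]

/-- More than `card ι` grids with distinct shifts modulo `1` have no common wall point. -/
theorem exists_gridWeight_ne_zero {P : Type*} [Fintype P] {r : P → ℝ}
    (hr : ∀ p q, ∀ k : ℤ, r p - r q = k → p = q) (hcard : Fintype.card ι < Fintype.card P)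
    (x : EuclideanSpace ℝ ι) : ∃ p, gridWeight s (r p) x ≠ 0 := by
  by_contra! h
  have hwall (p : P) : ∃ j, ∃ k : ℤ, (k : ℝ) = s * x j - r p := by
    by_contra! hp
    exact gridWeight_ne_zero_iff.2 hp (h p)
  choose wall k hk using hwall
  obtain ⟨p, q, hpq, heq⟩ := Fintype.exists_ne_map_eq_of_card_lt wall hcard
  refine hpq (hr p q (k q - k p) ?_)
  have hp := hk p
  have hq := hk q
  rw [heq] at hp
  push_cast
  linarith

end GridWeight

theorem eq_of_div_sub_div_eq_intCast {N : ℕ} (a b : Fin N) (k : ℤ)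
    (h : (a : ℝ) / N - (b : ℝ) / N = k) : a = b := by
  have hN : (N : ℝ) ≠ 0 := Nat.cast_ne_zero.2 a.pos.ne'
  have h' : ((a : ℤ) - (b : ℤ) : ℤ) = N * k := by
    field_simp at h
    exact_mod_cast h
  have hmod : (a : ℤ) ≡ b [ZMOD N] := (Int.modEq_iff_dvd.2 ⟨k, h'⟩).symm
  exact Fin.ext ((Int.natCast_modEq_iff.1 hmod).eq_of_lt_of_lt a.2 b.2)

theorem openWidth_le_of_gridWeight_ne_zero {ι C : Type*} [Fintype ι] [Fintype C] {d : ℕ}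
    (hC : Fintype.card C ≤ d + 1) {B : Set (EuclideanSpace ℝ ι)} {s : ℝ} (hs : 0 < s)
    (r : C → ℝ) {S : Set B} (hS : ∀ x ∈ S, ∃ c, gridWeight s (r c) x.1 ≠ 0) :
    openWidth d S ≤ (Fintype.card ι + 1) / s := by
  refine openWidth_le (𝒰 := {U | ∃ c, ∃ z, U = gridCell B s (r c) z}) (by positivity)
    ?_ ?_ ?_ ?_
  · rintro U ⟨c, z, rfl⟩
    exact isOpen_gridCell z
  · intro x hx
    obtain ⟨c, hc⟩ := hS x hx
    exact ⟨_, ⟨c, _, rfl⟩, mem_gridCell_floor (gridWeight_ne_zero_iff.1 hc)⟩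
  · intro x
    have hsub : {U ∈ {U | ∃ c, ∃ z, U = gridCell B s (r c) z} | x ∈ U} ⊆
        Set.range fun c => gridCell B s (r c) fun j => ⌊s * x.1 j - r c⌋ := by
      rintro U ⟨⟨c, z, rfl⟩, hx⟩
      exact ⟨c, congrArg _ (eq_floor_of_mem_gridCell hx).symm⟩
    refine ⟨(Set.finite_range _).subset hsub, (Set.ncard_le_ncard hsub).trans ?_⟩
    rw [← Set.image_univ]
    refine (Set.ncard_image_le).trans ?_
    rwa [Set.ncard_univ, Nat.card_eq_fintype_card]
  · rintro U ⟨c, z, rfl⟩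
    exact diam_gridCell_le hs z

/-- For `n = (m+1)(d+1) - 1` and any `ε > 0`, there is a continuous map from the
closed unit euclidean ball `B^n` to the standard `m`-simplex all of whose fibers
have Urysohn `d`-width less than `ε` (in the euclidean metric of the ball). -/
theorem exists_map_ball_to_simplex_small_fibers (m d : ℕ) (ε : ℝ) (hε : 0 < ε) :
    ∃ f : (Metric.closedBall (0 : EuclideanSpace ℝ (Fin ((m + 1) * (d + 1) - 1))) 1) →
        (Fin (m + 1) → ℝ),
      Continuous f ∧
      (∀ x, f x ∈ stdSimplex ℝ (Fin (m + 1))) ∧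
      ∀ t : Fin (m + 1) → ℝ, openWidth d (f ⁻¹' {t}) < ε := by
  set n := (m + 1) * (d + 1) - 1 with hn
  set s : ℝ := 2 * (n + 1) / ε with hs_def
  have hs : 0 < s := by positivity
  have hsε : ((Fintype.card (Fin n) : ℝ) + 1) / s < ε := by
    rw [Fintype.card_fin, div_lt_iff₀ hs, hs_def, mul_div_cancel₀ _ hε.ne']
    linarith [(Nat.cast_nonneg n : (0 : ℝ) ≤ n)]
  let r : Fin (m + 1) × Fin (d + 1) → ℝ := fun p =>
    (finProdFinEquiv p : ℕ) / (((m + 1) * (d + 1) : ℕ) : ℝ)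
  have hr (p q) (k : ℤ) (h : r p - r q = k) : p = q :=
    finProdFinEquiv.injective (eq_of_div_sub_div_eq_intCast _ _ k h)
  have hcard : Fintype.card (Fin n) < Fintype.card (Fin (m + 1) × Fin (d + 1)) := by
    simp only [Fintype.card_fin, Fintype.card_prod, hn]
    exact Nat.sub_lt (by positivity) one_pos
  let total : EuclideanSpace ℝ (Fin n) → ℝ := fun x => ∑ i, ∑ c, gridWeight s (r (i, c)) x
  have htotal (x) : 0 < total x := by
    obtain ⟨p, hp⟩ := exists_gridWeight_ne_zero (s := s) hr hcard x
    simp only [total, ← Fintype.sum_prod_type']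
    exact Finset.sum_pos' (fun p _ => gridWeight_nonneg _ _)
      ⟨p, Finset.mem_univ _, (gridWeight_nonneg _ _).lt_of_ne' hp⟩
  have hcont (p) : Continuous (gridWeight (ι := Fin n) s (r p)) := continuous_gridWeight _
  have hsimplex (x : EuclideanSpace ℝ (Fin n)) :
      (fun i => (∑ c, gridWeight s (r (i, c)) x) / total x) ∈ stdSimplex ℝ (Fin (m + 1)) := by
    refine ⟨fun i => div_nonneg (Finset.sum_nonneg fun c _ => gridWeight_nonneg _ _)
      (htotal x).le, ?_⟩
    rw [← Finset.sum_div]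
    exact div_self (htotal x).ne'
  refine ⟨fun x i => (∑ c, gridWeight s (r (i, c)) x.1) / total x.1, ?_,
    fun x => hsimplex x.1, fun t => ?_⟩
  · have htc : Continuous total := by fun_prop
    exact continuous_pi fun i => Continuous.div (by fun_prop) (by fun_prop)
      fun x => (htotal x.1).ne'
  · obtain ⟨i, hi⟩ : ∃ i, t i ≠ 0 ∨ t ∉ stdSimplex ℝ (Fin (m + 1)) := by
      by_contra! h
      have hsum := (h 0).2.2
      simp [fun i => (h i).1] at hsum
    refine (openWidth_le_of_gridWeight_ne_zero (by simp) hs (fun c => r (i, c)) ?_).trans_lt hsε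
    rintro x rfl
    by_contra! h
    rcases hi with hi | hi
    · exact hi (by simp [h])
    · exact hi (hsimplex x.1)
end

section
/- Fix an integer n ≥ 1 and ε > 0. There exists a simplicial complex K in ℝ^n (a collection of geometric simplices, closed under taking faces, any two of which intersect in a common face) which triangulates ℝ^n — i.e., the union of its simplices is all of ℝ^n — is locally finite (every point of ℝ^n has a neighborhood meeting only finitely many simplices of K), has all simplices of diameter less than ε, and admits a nice coloring: there is a function c from the vertex set of K to {0, 1, …, n} which is injective on the vertex set of each simplex of K (so each n-dimensional simplex receives all n+1 distinct colors). -/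
open MeasureTheory in
theorem integral_floor_add (a : ℝ) : ∫ t in Set.Ico (0 : ℝ) 1, (⌊a + t⌋ : ℝ) = a := by
  have hb := Int.fract_nonneg a
  have hb' := Int.fract_lt_one a
  have hf := Int.floor_add_fract a
  have h : ∀ t ∈ Set.Ico (0 : ℝ) 1, (⌊a + t⌋ : ℝ) =
      ⌊a⌋ + (Set.Ici (1 - Int.fract a)).indicator (fun _ => (1 : ℝ)) t := by
    rintro t ⟨h0, h1⟩
    by_cases ht : 1 - Int.fract a ≤ t
    · have : ⌊a + t⌋ = ⌊a⌋ + 1 := by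
        rw [Int.floor_eq_iff]; push_cast; constructor <;> linarith
      simp [ht, this]
    · have : ⌊a + t⌋ = ⌊a⌋ := by
        rw [Int.floor_eq_iff]; constructor <;> linarith
      simp [ht, this]
  rw [setIntegral_congr_fun measurableSet_Ico h, integral_add (by simp)
    ((integrable_indicator_iff measurableSet_Ici).2 (by
      rw [IntegrableOn, Measure.restrict_restrict measurableSet_Ici]
      exact integrableOn_const
        ((measure_mono Set.inter_subset_right).trans_lt measure_Ico_lt_top).ne)),
    integral_indicator measurableSet_Ici, Measure.restrict_restrict measurableSet_Ici]
  have : Set.Ici (1 - Int.fract a) ∩ Set.Ico 0 1 = Set.Ico (1 - Int.fract a) 1 := by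
    ext t
    simp only [Set.mem_inter_iff, Set.mem_Ici, Set.mem_Ico]
    constructor
    · rintro ⟨h1, h2, h3⟩; exact ⟨h1, h3⟩
    · rintro ⟨h1, h3⟩; exact ⟨h1, by linarith, h3⟩
  rw [this]
  simp [hb]

section Kuhn

variable {n : ℕ}

/-- A finite set of integer points is a simplex of the Kuhn (Freudenthal) triangulation if it is
a chain in the product order, all of whose members differ by at most one in each coordinate. -/
def IsKuhnSimplex (σ : Finset (Fin n → ℤ)) : Prop :=
  ∀ u ∈ σ, ∀ v ∈ σ, (u ≤ v ∧ v ≤ u + 1) ∨ (v ≤ u ∧ u ≤ v + 1)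

theorem IsKuhnSimplex.mono {σ τ : Finset (Fin n → ℤ)} (hσ : IsKuhnSimplex σ) (h : τ ⊆ σ) :
    IsKuhnSimplex τ :=
  fun u hu v hv => hσ u (h hu) v (h hv)

theorem IsKuhnSimplex.le_of_not_lt {σ : Finset (Fin n → ℤ)} (hσ : IsKuhnSimplex σ)
    {u v : Fin n → ℤ} (hu : u ∈ σ) (hv : v ∈ σ) (h : ¬ u < v) : v ≤ u := by
  rcases hσ u hu v hv with h' | h'
  · exact (eq_of_le_of_not_lt h'.1 h).ge
  · exact h'.1

theorem IsKuhnSimplex.le_add_one {σ : Finset (Fin n → ℤ)} (hσ : IsKuhnSimplex σ)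
    {u v : Fin n → ℤ} (hu : u ∈ σ) (hv : v ∈ σ) (i : Fin n) : u i ≤ v i + 1 := by
  rcases hσ u hu v hv with h | h
  · exact (h.1 i).trans (by simp)
  · exact h.2 i

open Classical in
theorem IsKuhnSimplex.floor_eq {σ : Finset (Fin n → ℤ)} (hσ : IsKuhnSimplex σ)
    {w : (Fin n → ℤ) → ℝ} (hw : ∀ u ∈ σ, 0 ≤ w u) (hw1 : ∑ u ∈ σ, w u = 1)
    {v : Fin n → ℤ} (hv : v ∈ σ) {t : ℝ}
    (h1 : ∑ u ∈ σ with u < v, w u ≤ t) (h2 : t < ∑ u ∈ σ with u ≤ v, w u) (i : Fin n) :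
    ⌊∑ u ∈ σ, w u * u i + t⌋ = v i := by
  rw [Finset.sum_filter] at h1 h2
  have e : ∑ u ∈ σ, w u * (v i : ℝ) = v i := by rw [← Finset.sum_mul, hw1, one_mul]
  rw [Int.floor_eq_iff]
  constructor
  · have : ∑ u ∈ σ, (w u * (v i : ℝ) - if u < v then w u else 0) ≤ ∑ u ∈ σ, w u * u i := by
      refine Finset.sum_le_sum fun u hu => ?_
      have hwu := hw u hu
      split_ifs with h
      · have : (v i : ℝ) ≤ u i + 1 := mod_cast hσ.le_add_one hv hu i
        nlinarith
      · have : (v i : ℝ) ≤ u i := mod_cast hσ.le_of_not_lt hu hv h i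
        nlinarith
    rw [Finset.sum_sub_distrib, e] at this
    linarith
  · have : ∑ u ∈ σ, w u * u i ≤
        ∑ u ∈ σ, (w u * (v i : ℝ) + (w u - if u ≤ v then w u else 0)) := by
      refine Finset.sum_le_sum fun u hu => ?_
      have hwu := hw u hu
      split_ifs with h
      · have : (u i : ℝ) ≤ v i := mod_cast h i
        nlinarith
      · have : (u i : ℝ) ≤ v i + 1 := mod_cast hσ.le_add_one hu hv i
        nlinarith
    rw [Finset.sum_add_distrib, Finset.sum_sub_distrib, e, hw1] at this
    linarith

open Classical in
theorem IsKuhnSimplex.exists_sum_lt_le {σ : Finset (Fin n → ℤ)} (hσ : IsKuhnSimplex σ)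
    {w : (Fin n → ℤ) → ℝ} (hw1 : ∑ u ∈ σ, w u = 1) (hw : ∀ u ∈ σ, 0 ≤ w u)
    {t : ℝ} (ht0 : 0 ≤ t) (ht1 : t < 1) :
    ∃ v ∈ σ, ∑ u ∈ σ with u < v, w u ≤ t ∧ t < ∑ u ∈ σ with u ≤ v, w u := by
  have hne : σ.Nonempty := by
    rw [Finset.nonempty_iff_ne_empty]; rintro rfl; simp at hw1
  obtain ⟨m, hm⟩ := Finset.exists_maximal hne
  have hmA : m ∈ σ.filter (fun v => t < ∑ u ∈ σ with u ≤ v, w u) := by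
    refine Finset.mem_filter.2 ⟨hm.1, ?_⟩
    rw [Finset.filter_true_of_mem, hw1]
    · exact ht1
    · exact fun u hu => hσ.le_of_not_lt hm.1 hu fun h => h.not_ge (hm.2 hu h.le)
  obtain ⟨v, hv⟩ := Finset.exists_minimal ⟨m, hmA⟩
  obtain ⟨hvσ, hvt⟩ := Finset.mem_filter.1 hv.1
  refine ⟨v, hvσ, ?_, hvt⟩
  rcases (σ.filter (· < v)).eq_empty_or_nonempty with h | h
  · rwa [h, Finset.sum_empty]
  · obtain ⟨k, hk⟩ := Finset.exists_maximal h
    obtain ⟨hkσ, hkv⟩ := Finset.mem_filter.1 hk.1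
    by_contra! hlt
    refine hkv.not_ge (hv.2 (Finset.mem_filter.2 ⟨hkσ, hlt.trans_le ?_⟩) hkv.le)
    refine Finset.sum_le_sum_of_subset_of_nonneg (fun u hu => ?_)
      fun u hu _ => hw u (Finset.mem_filter.1 hu).1
    have hu' := Finset.mem_filter.1 hu
    exact Finset.mem_filter.2 ⟨hu'.1, hσ.le_of_not_lt hkσ hu'.1
      fun h => h.not_ge (hk.2 hu h.le)⟩

/-- The point of the scaled integer lattice `δ ℤⁿ` with integer coordinates `z`. -/
def latticePoint (δ : ℝ) (z : Fin n → ℤ) : EuclideanSpace ℝ (Fin n) :=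
  WithLp.toLp 2 fun i => δ * z i

@[simp]
theorem latticePoint_apply (δ : ℝ) (z : Fin n → ℤ) (i : Fin n) :
    latticePoint δ z i = δ * z i := rfl

theorem latticePoint_injective {δ : ℝ} (hδ : 0 < δ) :
    Function.Injective (latticePoint (n := n) δ) := by
  intro u v h
  ext i
  have := congrArg (fun p : EuclideanSpace ℝ (Fin n) => p i) h
  simpa [hδ.ne'] using this

/-- The integer coordinates of `x / δ + (t, …, t)`, rounded down. -/
noncomputable def latticeFloor (δ : ℝ) (x : EuclideanSpace ℝ (Fin n)) (t : ℝ) : Fin n → ℤ :=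
  fun i => ⌊x i / δ + t⌋

theorem latticeFloor_mono (δ : ℝ) (x : EuclideanSpace ℝ (Fin n)) :
    Monotone (latticeFloor δ x) :=
  fun _ _ h _ => Int.floor_mono (by linarith)

theorem latticeFloor_le_add_one (δ : ℝ) (x : EuclideanSpace ℝ (Fin n)) {s t : ℝ}
    (hs : 0 ≤ s) (ht : t ≤ 1) : latticeFloor δ x t ≤ latticeFloor δ x s + 1 := by
  intro i
  rw [Pi.add_apply, Pi.one_apply, latticeFloor, latticeFloor, ← Int.floor_add_one]
  exact Int.floor_mono (by linarith)

theorem finite_latticeFloor_image (δ : ℝ) (x : EuclideanSpace ℝ (Fin n)) :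
    (latticeFloor δ x '' Set.Ico 0 1).Finite := by
  refine (Set.finite_Icc (latticeFloor δ x 0) (latticeFloor δ x 0 + 1)).subset ?_
  rintro _ ⟨t, ht, rfl⟩
  exact ⟨latticeFloor_mono δ x ht.1, latticeFloor_le_add_one δ x le_rfl ht.2.le⟩

theorem isKuhnSimplex_latticeFloor (δ : ℝ) (x : EuclideanSpace ℝ (Fin n)) :
    IsKuhnSimplex (finite_latticeFloor_image δ x).toFinset := by
  intro u hu v hv
  rw [Set.Finite.mem_toFinset] at hu hv
  obtain ⟨s, hs, rfl⟩ := hu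
  obtain ⟨t, ht, rfl⟩ := hv
  rcases le_total s t with h | h
  · exact Or.inl ⟨latticeFloor_mono δ x h, latticeFloor_le_add_one δ x hs.1 ht.2.le⟩
  · exact Or.inr ⟨latticeFloor_mono δ x h, latticeFloor_le_add_one δ x ht.1 hs.2.le⟩

open MeasureTheory in
theorem mem_convexHull_latticeFloor {δ : ℝ} (hδ : 0 < δ) (x : EuclideanSpace ℝ (Fin n)) :
    x ∈ convexHull ℝ (latticePoint δ '' (latticeFloor δ x '' Set.Ico 0 1)) := by
  have hfin := (finite_latticeFloor_image δ x).image (latticePoint δ)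
  have hprob : IsProbabilityMeasure (volume.restrict (Set.Ico (0 : ℝ) 1)) := ⟨by simp⟩
  have hmeas : Measurable fun t => latticePoint δ (latticeFloor δ x t) := by
    refine (PiLp.continuous_toLp 2 _).measurable.comp (measurable_pi_lambda _ fun i => ?_)
    have : Measurable fun t : ℝ => ⌊x i / δ + t⌋ := by fun_prop
    exact ((measurable_from_top (f := fun k : ℤ => (k : ℝ))).comp this).const_mul δ
  have hmem : ∀ᵐ t ∂(volume.restrict (Set.Ico (0 : ℝ) 1)),
      latticePoint δ (latticeFloor δ x t) ∈
        latticePoint δ '' (latticeFloor δ x '' Set.Ico 0 1) := by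
    filter_upwards [ae_restrict_mem measurableSet_Ico] with t ht
    exact ⟨_, ⟨t, ht, rfl⟩, rfl⟩
  have hint : Integrable (fun t => latticePoint δ (latticeFloor δ x t))
      (volume.restrict (Set.Ico (0 : ℝ) 1)) := by
    obtain ⟨C, hC⟩ := hfin.isBounded.exists_norm_le
    refine Integrable.of_bound hmeas.aestronglyMeasurable C ?_
    filter_upwards [hmem] with t ht using hC _ ht
  have key := (convex_convexHull ℝ _).integral_mem (hfin.isClosed_convexHull ℝ)
    (hmem.mono fun t ht => subset_convexHull ℝ _ ht) hint
  convert key using 1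
  ext i
  have := (EuclideanSpace.proj (𝕜 := ℝ) i).integral_comp_comm hint
  simp only [PiLp.proj_apply, latticePoint_apply] at this
  rw [← this, integral_const_mul]
  simp only [latticeFloor]
  rw [integral_floor_add]
  field_simp

open Classical in
theorem IsKuhnSimplex.latticeFloor_mem {δ : ℝ} (hδ : 0 < δ) {σ : Finset (Fin n → ℤ)}
    (hσ : IsKuhnSimplex σ) {x : EuclideanSpace ℝ (Fin n)}
    (hx : x ∈ convexHull ℝ (latticePoint δ '' (σ : Set (Fin n → ℤ)))) {t : ℝ}
    (ht : t ∈ Set.Ico (0 : ℝ) 1) : latticeFloor δ x t ∈ σ := by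
  rw [← Finset.coe_image, Finset.mem_convexHull'] at hx
  obtain ⟨w, hw, hw1, rfl⟩ := hx
  rw [Finset.sum_image (latticePoint_injective hδ).injOn] at hw1 ⊢
  have hw' : ∀ u ∈ σ, 0 ≤ w (latticePoint δ u) :=
    fun u hu => hw _ (Finset.mem_image_of_mem _ hu)
  obtain ⟨v, hv, h1, h2⟩ := hσ.exists_sum_lt_le hw1 hw' ht.1 ht.2
  convert hv
  ext i
  rw [← hσ.floor_eq hw' hw1 hv h1 h2 i, latticeFloor]
  congr 2
  simp only [WithLp.ofLp_sum, Finset.sum_apply, PiLp.smul_apply, latticePoint_apply, smul_eq_mul,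
    Finset.sum_div]
  refine Finset.sum_congr rfl fun u _ => ?_
  field_simp

open Classical in
theorem IsKuhnSimplex.affineIndependent {δ : ℝ} (hδ : 0 < δ) {σ : Finset (Fin n → ℤ)}
    (hσ : IsKuhnSimplex σ) :
    AffineIndependent ℝ ((↑) : σ.image (latticePoint δ) → EuclideanSpace ℝ (Fin n)) := by
  by_contra hdep
  have hne : σ.Nonempty := by
    rw [Finset.nonempty_iff_ne_empty]
    rintro rfl
    rw [Finset.image_empty] at hdep
    exact hdep (affineIndependent_of_subsingleton ℝ _)
  have hcard : (0 : ℝ) < σ.card := mod_cast hne.card_pos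
  set w : (Fin n → ℤ) → ℝ := fun _ => (σ.card : ℝ)⁻¹
  have hw0 : ∀ u, 0 < w u := fun _ => inv_pos.2 hcard
  have hw1 : ∑ u ∈ σ, w u = 1 := by simp [w, hcard.ne']
  set x := ∑ u ∈ σ, w u • latticePoint δ u with hxdef
  have hx : x ∈ convexHull ℝ ((σ.image (latticePoint δ) : Finset _) : Set _) :=
    (convex_convexHull ℝ _).sum_mem (fun u _ => (hw0 u).le) hw1
      fun u hu => subset_convexHull ℝ _ (Finset.mem_coe.2 (Finset.mem_image_of_mem _ hu))
  obtain ⟨⟨y, hy⟩, hxy⟩ := Caratheodory.mem_convexHull_erase hdep hx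
  obtain ⟨v, hv, rfl⟩ := Finset.mem_image.1 hy
  rw [← Finset.image_erase (latticePoint_injective hδ), Finset.coe_image] at hxy
  have hlt : ∑ u ∈ σ with u < v, w u < ∑ u ∈ σ with u ≤ v, w u :=
    Finset.sum_lt_sum_of_subset (i := v)
      (fun u hu => Finset.mem_filter.2 ⟨(Finset.mem_filter.1 hu).1, (Finset.mem_filter.1 hu).2.le⟩)
      (by simp [hv]) (by simp) (hw0 v) fun u _ _ => (hw0 u).le
  have hle : ∑ u ∈ σ with u ≤ v, w u ≤ 1 := hw1 ▸
    Finset.sum_le_sum_of_subset_of_nonneg (Finset.filter_subset _ _) fun u _ _ => (hw0 u).le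
  have hmem := (hσ.mono (σ.erase_subset v)).latticeFloor_mem hδ hxy
    (t := ∑ u ∈ σ with u < v, w u)
    ⟨Finset.sum_nonneg fun u _ => (hw0 u).le, hlt.trans_le hle⟩
  refine (Finset.mem_erase.1 hmem).1 ?_
  ext i
  rw [← hσ.floor_eq (fun u _ => (hw0 u).le) hw1 hv le_rfl hlt i, latticeFloor]
  congr 2
  simp only [hxdef, WithLp.ofLp_sum, Finset.sum_apply, PiLp.smul_apply, latticePoint_apply,
    smul_eq_mul, Finset.sum_div]
  refine Finset.sum_congr rfl fun u _ => ?_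
  field_simp

open Classical in
/-- The Kuhn (Freudenthal) triangulation of `ℝⁿ`, scaled by `δ`. -/
def kuhnComplex (n : ℕ) {δ : ℝ} (hδ : 0 < δ) :
    Geometry.SimplicialComplex ℝ (EuclideanSpace ℝ (Fin n)) where
  faces := {s | s.Nonempty ∧ ∃ σ, IsKuhnSimplex σ ∧ σ.image (latticePoint δ) = s}
  isRelLowerSet_faces := by
    rintro _ ⟨hne, σ, hσ, rfl⟩
    refine ⟨hne, fun t ht htne => ⟨htne, ?_⟩⟩
    obtain ⟨τ, hτ, rfl⟩ := Finset.subset_image_iff.1 ht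
    exact ⟨τ, hσ.mono (by simpa using hτ), rfl⟩
  indep := by
    rintro _ ⟨-, σ, hσ, rfl⟩
    exact hσ.affineIndependent hδ
  inter_subset_convexHull := by
    rintro _ _ ⟨-, σ, hσ, rfl⟩ ⟨-, τ, hτ, rfl⟩ x ⟨hxσ, hxτ⟩
    rw [Finset.coe_image] at hxσ hxτ
    refine convexHull_mono ?_ (mem_convexHull_latticeFloor hδ x)
    rintro _ ⟨_, ⟨t, ht, rfl⟩, rfl⟩
    simp only [Finset.coe_image]
    exact ⟨⟨_, hσ.latticeFloor_mem hδ hxσ ht, rfl⟩, ⟨_, hτ.latticeFloor_mem hδ hxτ ht, rfl⟩⟩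

theorem kuhnComplex_space {δ : ℝ} (hδ : 0 < δ) : (kuhnComplex n hδ).space = Set.univ := by
  classical
  refine Set.eq_univ_of_forall fun x => Geometry.SimplicialComplex.mem_space_iff.2 ?_
  refine ⟨(finite_latticeFloor_image δ x).toFinset.image (latticePoint δ),
    ⟨?_, _, isKuhnSimplex_latticeFloor δ x, by congr⟩, ?_⟩
  · refine Finset.Nonempty.image ⟨latticeFloor δ x 0, ?_⟩ _
    rw [Set.Finite.mem_toFinset]
    exact ⟨0, by simp, rfl⟩
  · simpa using mem_convexHull_latticeFloor hδ x

theorem kuhnComplex_locallyFinite {δ : ℝ} (hδ : 0 < δ) (x : EuclideanSpace ℝ (Fin n)) :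
    {s ∈ (kuhnComplex n hδ).faces | (Metric.ball x δ ∩
      convexHull ℝ (s : Set (EuclideanSpace ℝ (Fin n)))).Nonempty}.Finite := by
  classical
  set a := latticeFloor δ x 0
  refine ((Finset.Icc (a - 2) (a + 2)).image (latticePoint δ)).powerset.finite_toSet.subset ?_
  rintro _ ⟨⟨-, σ, hσ, rfl⟩, y, hyx, hy⟩
  rw [Finset.mem_coe, Finset.mem_powerset]
  rw [Finset.coe_image] at hy
  have hv : latticeFloor δ y 0 ∈ σ := hσ.latticeFloor_mem hδ hy ⟨le_rfl, one_pos⟩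
  have hva : ∀ i, a i - 1 ≤ latticeFloor δ y 0 i ∧ latticeFloor δ y 0 i ≤ a i + 1 := by
    intro i
    have h := (PiLp.norm_apply_le (y - x) i).trans_lt (mem_ball_iff_norm.1 hyx)
    rw [PiLp.sub_apply, Real.norm_eq_abs, abs_lt] at h
    have h1 : x i / δ - 1 ≤ y i / δ := by
      rw [div_sub_one hδ.ne']; gcongr; linarith
    have h2 : y i / δ ≤ x i / δ + 1 := by
      rw [div_add_one hδ.ne']; gcongr; linarith
    simp only [a, latticeFloor]
    rw [← Int.floor_sub_one, ← Int.floor_add_one]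
    exact ⟨Int.floor_mono (by linarith), Int.floor_mono (by linarith)⟩
  intro p hp
  obtain ⟨u, hu, rfl⟩ := Finset.mem_image.1 hp
  refine Finset.mem_image_of_mem _ (Finset.mem_Icc.2 ⟨fun i => ?_, fun i => ?_⟩)
  · have := hσ.le_add_one hv hu i
    have := (hva i).1
    simp only [Pi.sub_apply, Pi.ofNat_apply]
    omega
  · have := hσ.le_add_one hu hv i
    have := (hva i).2
    simp only [Pi.add_apply, Pi.ofNat_apply]
    omega

theorem kuhnComplex_diam_le {δ : ℝ} (hδ : 0 < δ) {s : Finset (EuclideanSpace ℝ (Fin n))}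
    (hs : s ∈ (kuhnComplex n hδ).faces) :
    Metric.diam (convexHull ℝ (s : Set (EuclideanSpace ℝ (Fin n)))) ≤ (n + 1) * δ := by
  obtain ⟨-, σ, hσ, rfl⟩ := hs
  rw [convexHull_diam]
  refine Metric.diam_le_of_forall_dist_le (by positivity) fun p hp q hq => ?_
  obtain ⟨u, hu, rfl⟩ := Finset.mem_image.1 hp
  obtain ⟨v, hv, rfl⟩ := Finset.mem_image.1 hq
  rw [EuclideanSpace.dist_eq]
  refine Real.sqrt_le_iff.2 ⟨by positivity, ?_⟩
  calc ∑ i, dist (latticePoint δ u i) (latticePoint δ v i) ^ 2 ≤ ∑ _i : Fin n, δ ^ 2 := by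
        refine Finset.sum_le_sum fun i _ => ?_
        have h1 : (u i : ℝ) ≤ v i + 1 := mod_cast hσ.le_add_one hu hv i
        have h2 : (v i : ℝ) ≤ u i + 1 := mod_cast hσ.le_add_one hv hu i
        gcongr
        rw [latticePoint_apply, latticePoint_apply, Real.dist_eq, abs_le]
        constructor <;> nlinarith
    _ = n * δ ^ 2 := by simp
    _ ≤ ((n + 1) * δ) ^ 2 := by
        have : (0 : ℝ) ≤ n := n.cast_nonneg
        nlinarith [sq_nonneg δ, mul_nonneg this (sq_nonneg δ),
          mul_nonneg (mul_nonneg this this) (sq_nonneg δ)]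

theorem eq_of_sum_intCast_eq {u v : Fin n → ℤ} (huv : u ≤ v) (hvu : v ≤ u + 1)
    (h : ((∑ i, u i : ℤ) : ZMod (n + 1)) = (∑ i, v i : ℤ)) : u = v := by
  rw [ZMod.intCast_eq_intCast_iff_dvd_sub] at h
  have h1 : ∑ i, v i ≤ ∑ i, u i + n := by
    calc ∑ i, v i ≤ ∑ i, (u i + 1) := Finset.sum_le_sum fun i _ => hvu i
      _ = ∑ i, u i + n := by simp [Finset.sum_add_distrib]
  have h0 : ∑ i, u i ≤ ∑ i, v i := Finset.sum_le_sum fun i _ => huv i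
  have h2 := Int.eq_zero_of_dvd_of_nonneg_of_lt (sub_nonneg.2 h0) (by push_cast; omega) h
  funext i
  exact (Finset.sum_eq_sum_iff_of_le fun i _ => huv i).1 (by omega) i (Finset.mem_univ i)

theorem kuhnComplex_exists_coloring {δ : ℝ} (hδ : 0 < δ) :
    ∃ c : EuclideanSpace ℝ (Fin n) → Fin (n + 1),
      ∀ s ∈ (kuhnComplex n hδ).faces, Set.InjOn c (s : Set (EuclideanSpace ℝ (Fin n))) := by
  let c : EuclideanSpace ℝ (Fin n) → ZMod (n + 1) :=
    fun p => (∑ i, Function.invFun (latticePoint δ) p i : ℤ)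
  have hc : ∀ z, c (latticePoint δ z) = (∑ i, z i : ℤ) := fun z => by
    simp only [c, Function.leftInverse_invFun (latticePoint_injective hδ) z]
  refine ⟨c, ?_⟩
  rintro _ ⟨-, σ, hσ, rfl⟩ p hp q hq hpq
  obtain ⟨u, hu, rfl⟩ := Finset.mem_image.1 hp
  obtain ⟨v, hv, rfl⟩ := Finset.mem_image.1 hq
  change c _ = c _ at hpq
  rw [hc, hc] at hpq
  rcases hσ u hu v hv with h | h
  · rw [eq_of_sum_intCast_eq h.1 h.2 hpq]
  · rw [eq_of_sum_intCast_eq h.1 h.2 hpq.symm]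

end Kuhn

/-- For every `n ≥ 1` and `ε > 0` there is a geometric simplicial complex in `ℝⁿ`
which triangulates `ℝⁿ` (its underlying space is all of `ℝⁿ`), is locally finite
(every point has a neighborhood meeting only finitely many faces), has all
simplices of diameter less than `ε`, and admits a nice coloring: a map `c` of the
vertices to the `n+1` colors `{0, …, n}` which is injective on each face, so each
`n`-simplex receives all `n+1` distinct colors. -/
theorem exists_colored_fine_triangulation (n : ℕ) (hn : 1 ≤ n) (ε : ℝ) (hε : 0 < ε) :
    ∃ K : Geometry.SimplicialComplex ℝ (EuclideanSpace ℝ (Fin n)),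
      K.space = Set.univ ∧
      (∀ x : EuclideanSpace ℝ (Fin n), ∃ U : Set (EuclideanSpace ℝ (Fin n)),
        IsOpen U ∧ x ∈ U ∧
        {s ∈ K.faces | (U ∩ convexHull ℝ (s : Set (EuclideanSpace ℝ (Fin n)))).Nonempty}.Finite) ∧
      (∀ s ∈ K.faces,
        Metric.diam (convexHull ℝ (s : Set (EuclideanSpace ℝ (Fin n)))) < ε) ∧
      ∃ c : EuclideanSpace ℝ (Fin n) → Fin (n + 1),
        ∀ s ∈ K.faces, Set.InjOn c (s : Set (EuclideanSpace ℝ (Fin n))) := by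
  have hδ : 0 < ε / (2 * (n + 1)) := by positivity
  refine ⟨kuhnComplex n hδ, kuhnComplex_space hδ,
    fun x => ⟨Metric.ball x _, Metric.isOpen_ball, Metric.mem_ball_self hδ,
      kuhnComplex_locallyFinite hδ x⟩,
    fun s hs => (kuhnComplex_diam_le hδ hs).trans_lt ?_, kuhnComplex_exists_coloring hδ⟩
  field_simp
  linarith
end

section
/- For every integer n ≥ 1, the Urysohn (n−1)-width of the closed unit euclidean ball B^n ⊂ ℝ^n is strictly positive: UW_{n-1}(B^n) > 0. Equivalently, there exists c > 0 such that in every finite cover of B^n by open sets in which every point lies in at most n of the sets, some set has diameter at least c. -/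
section NoRetraction

variable {E : Type*} [NormedAddCommGroup E] [InnerProductSpace ℝ E] [FiniteDimensional ℝ E]

theorem ContinuousLinearMap.det_one_add_pos_of_norm_lt_one (A : E →L[ℝ] E) (hA : ‖A‖ < 1) :
    0 < (1 + A).det := by
  by_contra! hneg
  have hcont : ContinuousOn (fun s : ℝ => (1 + s • A).det) (Set.Icc 0 1) :=
    (ContinuousLinearMap.continuous_det.comp (by fun_prop)).continuousOn
  have hmem : (0 : ℝ) ∈ Set.Icc (1 + (1 : ℝ) • A).det (1 + (0 : ℝ) • A).det := by
    refine ⟨by simpa using hneg, ?_⟩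
    simp [ContinuousLinearMap.det]
  obtain ⟨s, hs, hdet⟩ := intermediate_value_Icc' zero_le_one hcont hmem
  obtain ⟨x, hx, hx0⟩ := (Submodule.ne_bot_iff _).1
    (LinearMap.bot_lt_ker_of_det_eq_zero (f := ((1 + s • A : E →L[ℝ] E) : E →ₗ[ℝ] E)) hdet).ne'
  have hx' : x + s • A x = 0 := by simpa using hx
  have hle : ‖x‖ ≤ ‖A‖ * ‖x‖ := by
    calc ‖x‖ = ‖s • A x‖ := by
          rw [← norm_neg (s • A x), ← eq_neg_of_add_eq_zero_left hx']
      _ = s * ‖A x‖ := by rw [norm_smul, Real.norm_of_nonneg hs.1]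
      _ ≤ 1 * ‖A x‖ := by gcongr; exact hs.2
      _ ≤ ‖A‖ * ‖x‖ := by rw [one_mul]; exact A.le_opNorm x
  nlinarith [norm_pos_iff.2 hx0]

/-- Lagrange interpolation of the polynomial `t ↦ det (1 + t A)` at `t = 1`. -/
theorem ContinuousLinearMap.det_one_add_eq_sum_lagrange (s : Finset ℝ)
    (hs : Module.finrank ℝ E < s.card) (A : E →L[ℝ] E) :
    (1 + A).det = ∑ t ∈ s, (Lagrange.basis s id t).eval 1 * (1 + t • A).det := by
  set b := Module.finBasis ℝ E
  set M := LinearMap.toMatrix b b (A : E →ₗ[ℝ] E)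
  set P : Polynomial ℝ := Matrix.det ((Polynomial.X : Polynomial ℝ) • M.map Polynomial.C +
    (1 : Matrix (Fin (Module.finrank ℝ E)) (Fin (Module.finrank ℝ E)) ℝ).map Polynomial.C) with hP
  have heval (t : ℝ) : P.eval t = (1 + t • A).det := by
    have hmat : LinearMap.toMatrix b b ((1 + t • A : E →L[ℝ] E) : E →ₗ[ℝ] E) = t • M + 1 := by
      have : ((1 + t • A : E →L[ℝ] E) : E →ₗ[ℝ] E) = t • (A : E →ₗ[ℝ] E) + LinearMap.id := by
        ext x; simp [add_comm]
      rw [this, map_add, map_smul, LinearMap.toMatrix_id]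
    rw [ContinuousLinearMap.det, ← LinearMap.det_toMatrix b, hmat, hP, ← Polynomial.coe_evalRingHom,
      RingHom.map_det]
    congr 1
    ext i j
    rcases eq_or_ne i j with rfl | h <;> simp [*, mul_comm t]
  have hdeg : P.degree < s.card := by
    refine lt_of_le_of_lt Polynomial.degree_le_natDegree ?_
    have := Polynomial.natDegree_det_X_add_C_le M 1
    rw [Fintype.card_fin] at this
    exact_mod_cast lt_of_le_of_lt this hs
  have hint := Lagrange.eq_interpolate (v := id) Function.injective_id.injOn hdeg
  have h1 := heval 1
  rw [one_smul] at h1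
  rw [← h1]
  conv_lhs => rw [hint]
  rw [Lagrange.interpolate_apply, Polynomial.eval_finsetSum]
  exact Finset.sum_congr rfl fun t _ => by simp [heval, mul_comm]

open scoped NNReal in
/-- A small perturbation of the identity that fixes the unit sphere is a bijection of the
open unit ball. -/
theorem injOn_and_image_ball_eq_of_approximatesLinearOn_refl {h : E → E} {K : ℝ≥0} (hK : K < 1)
    (hlip : ApproximatesLinearOn h (ContinuousLinearEquiv.refl ℝ E : E →L[ℝ] E)
      (Metric.closedBall 0 1) K)
    (hmaps : Set.MapsTo h (Metric.ball 0 1) (Metric.ball 0 1))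
    (hsphere : ∀ x ∈ Metric.sphere (0 : E) 1, h x = x) :
    Set.InjOn h (Metric.ball 0 1) ∧ h '' Metric.ball 0 1 = Metric.ball 0 1 := by
  have hc : Subsingleton E ∨
      K < ‖((ContinuousLinearEquiv.refl ℝ E).symm : E →L[ℝ] E)‖₊⁻¹ := by
    rcases subsingleton_or_nontrivial E with hE | hE
    · exact .inl hE
    · right
      have : ‖((ContinuousLinearEquiv.refl ℝ E).symm : E →L[ℝ] E)‖₊ = 1 :=
        NNReal.eq ContinuousLinearMap.norm_id
      rw [this, inv_one]
      exact hK
  have hlip' := hlip.mono_set Metric.ball_subset_closedBall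
  have hopen : IsOpen (h '' Metric.ball 0 1) :=
    hlip'.open_image (ContinuousLinearEquiv.refl ℝ E).toNonlinearRightInverse Metric.isOpen_ball hc
  have hcompact : IsCompact (h '' Metric.closedBall 0 1) :=
    (isCompact_closedBall 0 1).image_of_continuousOn hlip.continuousOn
  refine ⟨hlip'.injOn hc, hmaps.image_subset.antisymm ?_⟩
  refine (convex_ball (0 : E) 1).isPreconnected.subset_of_closure_inter_subset hopen ?_ ?_
  · exact ⟨h 0, hmaps (by simp), Set.mem_image_of_mem h (by simp)⟩
  · rintro y ⟨hy, hyb⟩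
    obtain ⟨x, hx, rfl⟩ := closure_minimal
      (Set.image_mono Metric.ball_subset_closedBall) hcompact.isClosed hy
    rcases (mem_closedBall_zero_iff.1 hx).lt_or_eq with hlt | heq
    · exact Set.mem_image_of_mem h (mem_ball_zero_iff.2 hlt)
    · rw [hsphere x (by simpa using heq), mem_ball_zero_iff, heq] at hyb
      exact absurd hyb (lt_irrefl _)

open MeasureTheory in
/-- There is no `C¹` retraction onto the unit sphere. -/
theorem ContDiff.false_of_norm_eq_one_of_eqOn_sphere {f : E → E} (hf : ContDiff ℝ 1 f)
    (hnorm : ∀ x, ‖f x‖ = 1) (hsphere : ∀ x ∈ Metric.sphere (0 : E) 1, f x = x) : False := by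
  let _ : MeasurableSpace E := borel E
  have : BorelSpace E := ⟨rfl⟩
  let μ : Measure E := Measure.addHaar
  let g : E → E := fun x => f x - x
  have hg : ContDiff ℝ 1 g := hf.sub contDiff_id
  have hgd (x : E) : HasFDerivAt g (fderiv ℝ g x) x :=
    (hg.differentiable one_ne_zero x).hasFDerivAt
  have hdet_zero (x : E) : (1 + fderiv ℝ g x).det = 0 := by
    have hfd : HasFDerivAt f (1 + fderiv ℝ g x) x := by
      have := (hasFDerivAt_id x).add (hgd x)
      refine this.congr_of_eventuallyEq (.of_forall fun y => ?_)
      simp [g]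
    by_contra hne
    have hunit : IsUnit ((1 + fderiv ℝ g x : E →L[ℝ] E) : E →ₗ[ℝ] E) :=
      (LinearMap.isUnit_iff_isUnit_det _).2 (isUnit_iff_ne_zero.2 hne)
    obtain ⟨v, hv⟩ := ((Module.End.isUnit_iff _).1 hunit).2 (f x)
    have hsq := hfd.norm_sq
    have hconst : (fun y => ‖f y‖ ^ 2) = fun _ => (1 : ℝ) := by ext y; simp [hnorm]
    rw [hconst] at hsq
    have := congrArg (fun T => T v) (hsq.unique (hasFDerivAt_const 1 x))
    have hv' : (1 + fderiv ℝ g x) v = f x := hv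
    rw [smul_apply, ContinuousLinearMap.comp_apply, hv', innerSL_apply_apply,
      real_inner_self_eq_norm_sq, hnorm] at this
    simp at this
  obtain ⟨K, hK⟩ := hg.locallyLipschitz.locallyLipschitzOn.exists_lipschitzOnWith_of_compact
    (isCompact_closedBall (0 : E) 1)
  have hvol (t : ℝ) (ht0 : 0 < t) (ht1 : t * (K + 1) < 1) :
      (∫ x in Metric.ball (0 : E) 1, (1 + t • fderiv ℝ g x).det ∂μ) =
        μ.real (Metric.ball (0 : E) 1) := by
    have htK : t * K < 1 := by nlinarith
    have ht : t < 1 := by nlinarith [K.coe_nonneg]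
    have hb := injOn_and_image_ball_eq_of_approximatesLinearOn_refl (h := fun x => x + t • g x)
      (K := t.toNNReal * K) (by
        rw [← NNReal.coe_lt_coe]; simpa [ht0.le] using htK) ?_ ?_ ?_
    · have hpos : ∀ x ∈ Metric.ball (0 : E) 1,
          (1 + t • fderiv ℝ g x).det = |(1 + t • fderiv ℝ g x).det| • (1 : ℝ) := by
        intro x hx
        rw [smul_eq_mul, mul_one, abs_of_pos]
        apply ContinuousLinearMap.det_one_add_pos_of_norm_lt_one
        rw [norm_smul, Real.norm_of_nonneg ht0.le]
        refine lt_of_le_of_lt ?_ htK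
        gcongr
        exact (hgd x).le_of_lipschitzOn (Metric.closedBall_mem_nhds_of_mem hx) hK
      rw [setIntegral_congr_fun measurableSet_ball hpos,
        ← integral_image_eq_integral_abs_det_fderiv_smul μ measurableSet_ball
          (f := fun x => x + t • g x) (f' := fun x => 1 + t • fderiv ℝ g x) (fun x _ =>
            ((hasFDerivAt_id x).add ((hgd x).const_smul t)).hasFDerivWithinAt) hb.1
          (fun _ => (1 : ℝ)),
        hb.2]
      simp
    · intro x hx y hy
      have := hK.dist_le_mul x hx y hy
      rw [dist_eq_norm, dist_eq_norm] at this
      calc _ = ‖t • (g x - g y)‖ := by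
            congr 1
            simp only [ContinuousLinearEquiv.coe_refl, ContinuousLinearMap.id_apply, smul_sub]
            abel
        _ = t * ‖g x - g y‖ := by rw [norm_smul, Real.norm_of_nonneg ht0.le]
        _ ≤ t * (K * ‖x - y‖) := by gcongr
        _ = _ := by simp [mul_assoc, ht0.le]
    · intro x hx
      rw [mem_ball_zero_iff] at hx ⊢
      calc ‖x + t • g x‖ = ‖(1 - t) • x + t • f x‖ := by
            congr 1; simp only [g]; module
        _ ≤ (1 - t) * ‖x‖ + t * ‖f x‖ := by
            refine (norm_add_le _ _).trans_eq ?_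
            rw [norm_smul, norm_smul, Real.norm_of_nonneg ht0.le,
              Real.norm_of_nonneg (by linarith)]
        _ < 1 := by rw [hnorm]; nlinarith
    · intro x hx
      simp [g, hsphere x hx]
  obtain ⟨s, hsub, hcard⟩ := (Set.Ioo_infinite
    (show (0 : ℝ) < 1 / (K + 1) by positivity)).exists_subset_card_eq (Module.finrank ℝ E + 1)
  have hcardlt : Module.finrank ℝ E < s.card := by omega
  have hsum : ∑ t ∈ s, (Lagrange.basis s id t).eval 1 = (1 : ℝ) := by
    rw [← Polynomial.eval_finsetSum, Lagrange.sum_basis Function.injective_id.injOn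
      (Finset.card_pos.1 (by omega)), Polynomial.eval_one]
  have hcontd : Continuous (fderiv ℝ g) := hg.continuous_fderiv one_ne_zero
  have key : (0 : ℝ) = μ.real (Metric.ball (0 : E) 1) := by
    calc (0 : ℝ) = ∫ x in Metric.ball (0 : E) 1, (1 + fderiv ℝ g x).det ∂μ := by
          simp [hdet_zero]
      _ = ∫ x in Metric.ball (0 : E) 1,
            ∑ t ∈ s, (Lagrange.basis s id t).eval 1 * (1 + t • fderiv ℝ g x).det ∂μ := by
          simp_rw [← ContinuousLinearMap.det_one_add_eq_sum_lagrange s hcardlt]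
      _ = ∑ t ∈ s, (Lagrange.basis s id t).eval 1 *
            ∫ x in Metric.ball (0 : E) 1, (1 + t • fderiv ℝ g x).det ∂μ := by
          rw [integral_finsetSum]
          · simp_rw [integral_const_mul]
          · intro t _
            refine Integrable.const_mul ?_ _
            have : Continuous fun x => (1 + t • fderiv ℝ g x).det :=
              ContinuousLinearMap.continuous_det.comp (by fun_prop)
            exact (this.continuousOn.integrableOn_compact
              (isCompact_closedBall (0 : E) 1)).mono_set Metric.ball_subset_closedBall
      _ = ∑ t ∈ s, (Lagrange.basis s id t).eval 1 * μ.real (Metric.ball (0 : E) 1) := by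
          refine Finset.sum_congr rfl fun t ht => ?_
          have := hsub ht
          rw [hvol t this.1 ((lt_div_iff₀ (by positivity)).1 this.2)]
      _ = μ.real (Metric.ball (0 : E) 1) := by rw [← Finset.sum_mul, hsum, one_mul]
  have hp : 0 < μ.real (Metric.ball (0 : E) 1) :=
    ENNReal.toReal_pos (Metric.measure_ball_pos μ 0 one_pos).ne' measure_ball_lt_top.ne
  exact hp.ne key

/-- A `C¹` map that moves the points of the closed unit ball by less than `1 / 4` attains on that
ball every value of norm less than `1 / 4`. -/
theorem ContDiff.mem_image_closedBall_of_norm_sub_lt {φ : E → E} (hφ : ContDiff ℝ 1 φ)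
    (hclose : ∀ x ∈ Metric.closedBall (0 : E) 1, ‖φ x - x‖ < 1 / 4) {p : E} (hp : ‖p‖ < 1 / 4) :
    p ∈ φ '' Metric.closedBall 0 1 := by
  by_contra hmiss
  let b : ContDiffBump (0 : E) := ⟨2 / 3, 1, by norm_num, by norm_num⟩
  let ψ : E → E := fun x => x + b ((4 / 3 : ℝ) • (x - p)) • (φ x - x)
  have hψ : ContDiff ℝ 1 ψ := by
    have : ContDiff ℝ 1 b := b.contDiff
    have h2 : ContDiff ℝ 1 fun x : E => b ((4 / 3 : ℝ) • (x - p)) := this.comp (by fun_prop)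
    exact contDiff_id.add (h2.smul (hφ.sub contDiff_id))
  have hout {x : E} (hx : 3 / 4 ≤ ‖x - p‖) : ψ x = x := by
    have : b ((4 / 3 : ℝ) • (x - p)) = 0 := b.zero_of_le_dist (by
      rw [dist_zero_right, norm_smul, Real.norm_of_nonneg (by norm_num)]
      change (1 : ℝ) ≤ _
      linarith)
    simp [ψ, this]
  have hne (x : E) : ψ x - p ≠ 0 := by
    rw [sub_ne_zero]
    intro hx
    rcases le_or_gt (3 / 4) ‖x - p‖ with h | h
    · rw [hout h] at hx
      simp [hx] at h
      norm_num at h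
    have hxball : x ∈ Metric.closedBall (0 : E) 1 := by
      rw [mem_closedBall_zero_iff]
      have := norm_add_le (x - p) p
      rw [sub_add_cancel] at this
      linarith
    rcases le_or_gt ‖x - p‖ (1 / 2) with h2 | h2
    · have : b ((4 / 3 : ℝ) • (x - p)) = 1 := b.one_of_mem_closedBall (by
        rw [mem_closedBall_zero_iff, norm_smul, Real.norm_of_nonneg (by norm_num)]
        change _ ≤ (2 / 3 : ℝ)
        linarith)
      refine hmiss ⟨x, hxball, ?_⟩
      simpa [ψ, this] using hx
    · have h3 : x - p = -(b ((4 / 3 : ℝ) • (x - p)) • (φ x - x)) := by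
        nth_rewrite 1 [← hx]
        simp [ψ]
      have h4 : ‖x - p‖ ≤ 1 * ‖φ x - x‖ := by
        rw [h3, norm_neg, norm_smul, Real.norm_of_nonneg b.nonneg]
        gcongr
        exact b.le_one
      linarith [hclose x hxball]
  let F : E → E := fun u => ‖ψ (p + (3 / 4 : ℝ) • u) - p‖⁻¹ • (ψ (p + (3 / 4 : ℝ) • u) - p)
  have hin : ContDiff ℝ 1 fun u : E => ψ (p + (3 / 4 : ℝ) • u) - p :=
    (hψ.comp (by fun_prop : ContDiff ℝ 1 fun u : E => p + (3 / 4 : ℝ) • u)).sub contDiff_const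
  refine ContDiff.false_of_norm_eq_one_of_eqOn_sphere (f := F)
    (((hin.norm ℝ fun _ => hne _).inv fun _ => norm_ne_zero_iff.2 (hne _)).smul hin)
    (fun u => ?_) (fun u hu => ?_)
  · simp only [F, norm_smul, norm_inv, norm_norm]
    exact inv_mul_cancel₀ (norm_ne_zero_iff.2 (hne _))
  · rw [mem_sphere_zero_iff_norm] at hu
    have hn : ‖(3 / 4 : ℝ) • u‖ = 3 / 4 := by
      rw [norm_smul, hu, Real.norm_of_nonneg (by norm_num), mul_one]
    have := hout (x := p + (3 / 4 : ℝ) • u) (by rw [add_sub_cancel_left, hn])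
    simp only [F, this, add_sub_cancel_left, hn, smul_smul]
    norm_num

end NoRetraction

open MeasureTheory in
/-- The affine spans of the at most `finrank E`-element subfamilies of a finite family of points
form a null set. -/
theorem addHaar_iUnion_affineSpan_eq_zero {E ι : Type*} [NormedAddCommGroup E]
    [NormedSpace ℝ E] [FiniteDimensional ℝ E] [MeasurableSpace E] [BorelSpace E] (μ : Measure E)
    [μ.IsAddHaarMeasure] [Finite ι] [Nontrivial E] (p : ι → E) :
    μ (⋃ t : {t : Finset ι // t.card ≤ Module.finrank ℝ E},
      (affineSpan ℝ (p '' (t : Finset ι)) : Set E)) = 0 := by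
  classical
  refine measure_iUnion_null fun ⟨t, ht⟩ => Measure.addHaar_affineSubspace μ _ fun htop => ?_
  rcases t.eq_empty_or_nonempty with rfl | hne
  · simp at htop
  obtain ⟨m, hm⟩ := Nat.exists_eq_succ_of_ne_zero (Finset.card_pos.2 hne).ne'
  have h1 := finrank_vectorSpan_image_finset_le ℝ p t hm
  rw [Finset.coe_image, ← direction_affineSpan] at h1
  rw [htop, AffineSubspace.direction_top, finrank_top] at h1
  omega


/-- **Lebesgue covering theorem** for the unit ball: a finite cover by small open sets has more
than `finrank E` members with a common point. -/
theorem exists_finrank_lt_card_of_closedBall_subset_iUnion {E ι : Type*} [NormedAddCommGroup E]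
    [InnerProductSpace ℝ E] [FiniteDimensional ℝ E] [Nontrivial E] [Fintype ι] {V : ι → Set E}
    (hV : ∀ i, IsOpen (V i)) (hcov : Metric.closedBall 0 1 ⊆ ⋃ i, V i) (p : ι → E)
    (hp : ∀ i, ∀ x ∈ Metric.closedBall 0 1, x ∈ V i → dist (p i) x < 1 / 4) :
    ∃ x ∈ Metric.closedBall (0 : E) 1, ∃ S : Finset ι,
      Module.finrank ℝ E < S.card ∧ ∀ i ∈ S, x ∈ V i := by
  classical
  let _ : MeasurableSpace E := borel E
  have : BorelSpace E := ⟨rfl⟩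
  obtain ⟨ρ, hρ⟩ := SmoothPartitionOfUnity.exists_isSubordinate
    (modelWithCornersSelf ℝ E) (Metric.isClosed_closedBall (x := (0 : E)) (ε := 1)) V hV hcov
  let φ : E → E := fun x => ∑ i, ρ i x • p i
  let S : E → Finset ι := fun x => {i | ρ i x ≠ 0}
  have hmemV {x : E} {i : ι} (hi : i ∈ S x) : x ∈ V i :=
    hρ i (subset_tsupport _ (by simpa [S] using hi))
  have hφmem {x : E} (hx : x ∈ Metric.closedBall (0 : E) 1) {C : Set E} (hC : Convex ℝ C)
      (hpC : ∀ i ∈ S x, p i ∈ C) : φ x ∈ C := by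
    have hφS : ∑ i ∈ S x, ρ i x • p i = φ x :=
      Finset.sum_filter_of_ne fun i _ h => left_ne_zero_of_smul h
    have hsum := ρ.sum_eq_one hx
    rw [finsum_eq_sum_of_fintype, ← Finset.sum_filter_ne_zero] at hsum
    rw [← hφS]
    exact hC.sum_mem (fun i _ => ρ.nonneg i x) hsum hpC
  have hφ : ContDiff ℝ 1 φ := ContDiff.sum fun i _ =>
    ((ρ i).contMDiff.contDiff.of_le (by simp)).smul contDiff_const
  have hclose (x : E) (hx : x ∈ Metric.closedBall (0 : E) 1) : ‖φ x - x‖ < 1 / 4 := by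
    rw [← dist_eq_norm, ← Metric.mem_ball]
    exact hφmem hx (convex_ball x _) fun i hi => hp i x hx (hmemV hi)
  by_contra! hcard
  refine (Metric.measure_ball_pos MeasureTheory.Measure.addHaar (0 : E)
    (by norm_num : (0 : ℝ) < 1 / 4)).ne' (MeasureTheory.measure_mono_null ?_
      (addHaar_iUnion_affineSpan_eq_zero MeasureTheory.Measure.addHaar p))
  intro q hq
  obtain ⟨x, hx, rfl⟩ := hφ.mem_image_closedBall_of_norm_sub_lt hclose (mem_ball_zero_iff.1 hq)
  have hSx : (S x).card ≤ Module.finrank ℝ E := by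
    by_contra! hlt
    obtain ⟨i, hi, hiV⟩ := hcard x hx (S x) hlt
    exact hiV (hmemV hi)
  exact Set.mem_iUnion.2 ⟨⟨S x, hSx⟩, hφmem hx (AffineSubspace.convex _) fun i hi =>
    subset_affineSpan ℝ _ ⟨i, hi, rfl⟩⟩

/-- For every `n ≥ 1`, the Urysohn `(n-1)`-width of the closed unit euclidean
ball `Bⁿ ⊆ ℝⁿ` is strictly positive. -/
theorem urysohnWidth_ball_pos (n : ℕ) (hn : 1 ≤ n) :
    0 < openWidth (n - 1)
      (Set.univ : Set (Metric.closedBall (0 : EuclideanSpace ℝ (Fin n)) 1)) := by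
  classical
  have : Nontrivial (EuclideanSpace ℝ (Fin n)) :=
    Module.nontrivial_of_finrank_pos (R := ℝ) (by rw [finrank_euclideanSpace_fin]; exact hn)
  set X := Metric.closedBall (0 : EuclideanSpace ℝ (Fin n)) 1
  have : CompactSpace X := isCompact_iff_compactSpace.1 (isCompact_closedBall 0 1)
  rw [openWidth]
  refine lt_of_lt_of_le (by norm_num : (0 : ℝ) < 1 / 4) (le_csInf ?_ ?_)
  · refine ⟨Metric.diam (Set.univ : Set X), {Set.univ}, by simp, by simp, fun x => ?_, by simp⟩
    have : {U ∈ ({Set.univ} : Set (Set X)) | x ∈ U} = {Set.univ} := by ext; aesop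
    rw [this]
    simp
  rintro w ⟨𝒰, hopen, hcov, hmult, hdiam⟩
  by_contra! hw
  obtain ⟨t, ht⟩ := isCompact_univ.elim_finite_subcover (fun U : 𝒰 => (U : Set X))
    (fun U => hopen U U.2) (by rwa [← Set.sUnion_eq_iUnion])
  have hV (U : t) : ∃ V : Set (EuclideanSpace ℝ (Fin n)),
      IsOpen V ∧ Subtype.val ⁻¹' V = ((U : 𝒰) : Set X) :=
    isOpen_induced_iff.1 (hopen _ U.1.2)
  choose V hVo hVU using hV
  have hmem {x : EuclideanSpace ℝ (Fin n)} (hx : x ∈ X) (U : t) :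
      x ∈ V U ↔ (⟨x, hx⟩ : X) ∈ ((U : 𝒰) : Set X) := by
    rw [← hVU, Set.mem_preimage]
  have hp (U : t) : ∃ p : EuclideanSpace ℝ (Fin n),
      ∀ x ∈ ((U : 𝒰) : Set X), dist p x < 1 / 4 := by
    rcases ((U : 𝒰) : Set X).eq_empty_or_nonempty with h | ⟨y, hy⟩
    · exact ⟨0, by simp [h]⟩
    · exact ⟨y, fun x hx => ((Metric.dist_le_diam_of_mem
        (isCompact_univ.isBounded.subset (Set.subset_univ _)) hy hx).trans
          (hdiam _ U.1.2)).trans_lt hw⟩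
  choose p hp using hp
  have hcovV : X ⊆ ⋃ U, V U := by
    intro x hx
    obtain ⟨U, hU⟩ := Set.mem_iUnion.1 (ht (Set.mem_univ ⟨x, hx⟩))
    obtain ⟨hUt, hxU⟩ := Set.mem_iUnion.1 hU
    exact Set.mem_iUnion.2 ⟨⟨U, hUt⟩, (hmem hx _).2 hxU⟩
  have hpV (U : t) (x : EuclideanSpace ℝ (Fin n)) (hx : x ∈ X) (hxV : x ∈ V U) :
      dist (p U) x < 1 / 4 := hp U ⟨x, hx⟩ ((hmem hx U).1 hxV)
  obtain ⟨x, hx, S, hcard, hS⟩ :=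
    exists_finrank_lt_card_of_closedBall_subset_iUnion hVo hcovV p hpV
  have hinj : Function.Injective fun i : t => ((i : 𝒰) : Set X) :=
    Subtype.val_injective.comp Subtype.val_injective
  rw [finrank_euclideanSpace_fin, ← Finset.card_image_of_injective _ hinj,
    ← Set.ncard_coe_finset] at hcard
  have hle := (Set.ncard_le_ncard (s := (S.image fun i : t => ((i : 𝒰) : Set X) : Set (Set X)))
    (fun U hU => by
      obtain ⟨i, hi, rfl⟩ := Finset.mem_image.1 (Finset.mem_coe.1 hU)
      exact ⟨i.1.2, (hmem hx i).1 (hS i hi)⟩) (hmult ⟨x, hx⟩).1).trans (hmult ⟨x, hx⟩).2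
  omega
end
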